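/- arXiv:1208.3568 — 3 statements merged into one kernel-verified Lean document; each statement's English description precedes it below -/
import Mathlib

section
/- There is an absolute constant C > 0 such that for every ε > 0 and every integer t ≥ 3 there exists n₀ = n₀(ε,t) with the following property: every finite simple graph G on n ≥ n₀ vertices with d(G) ≥ c(t) + ε contains a K_t-minor of order at most C·(c(t)·t²/ε)·log n·log log n. -/
open Real

/-- Edge density `d(G) = |E(G)|/|V(G)|`. -/
noncomputable def density {V : Type*} (G : SimpleGraph V) : ℝ :=
  G.edgeSet.ncard / Nat.card V

/-- External neighborhood `N(S)`: vertices outside `S` adjacent to some vertex of `S`. -/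
def nbhd {V : Type*} (G : SimpleGraph V) (S : Set V) : Set V :=
  {v | v ∉ S ∧ ∃ u ∈ S, G.Adj u v}

/-- `G` contains a `K_t`-minor (branch sets are disjoint, nonempty, connected,
pairwise joined by an edge). -/
def HasKtMinor {V : Type*} (G : SimpleGraph V) (t : ℕ) : Prop :=
  ∃ P : Fin t → Set V,
    (∀ i, (P i).Nonempty) ∧
    (Pairwise (Function.onFun Disjoint P)) ∧
    (∀ i, (G.induce (P i)).Connected) ∧
    (∀ i j : Fin t, i < j → ∃ u ∈ P i, ∃ v ∈ P j, G.Adj u v)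

/-- `G` contains a `K_t`-minor of order at most `k`. -/
def HasKtMinorOfOrder {V : Type*} (G : SimpleGraph V) (t : ℕ) (k : ℝ) : Prop :=
  ∃ P : Fin t → Set V,
    (∀ i, (P i).Nonempty) ∧
    (Pairwise (Function.onFun Disjoint P)) ∧
    (∀ i, (G.induce (P i)).Connected) ∧
    (∀ i j : Fin t, i < j → ∃ u ∈ P i, ∃ v ∈ P j, G.Adj u v) ∧
    ((⋃ i, P i).ncard : ℝ) ≤ k

/-- `c(t)`: the least `c` such that every graph of density at least `c` has a `K_t`-minor. -/
noncomputable def minorThreshold (t : ℕ) : ℝ :=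
  sInf {c : ℝ | ∀ (n : ℕ) (G : SimpleGraph (Fin n)), density G ≥ c → HasKtMinor G t}

/-- `δ`-expander. -/
def IsDeltaExpander {V : Type*} (G : SimpleGraph V) (δ : ℝ) : Prop :=
  ∀ d : ℕ, (d : ℝ) ≤ logb 2 (logb 2 (Nat.card V)) - 1 →
    ∀ S : Set V, (S.ncard : ℝ) ≤ (Nat.card V : ℝ) / (2 : ℝ) ^ (2 ^ d : ℕ) →
      ((nbhd G S).ncard : ℝ) ≥
        δ * 2 ^ d / (logb 2 (Nat.card V) * (logb 2 (logb 2 (Nat.card V))) ^ 2) * S.ncard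

/-- `(δ, n)`-expander. -/
def IsDeltaNExpander {V : Type*} (G : SimpleGraph V) (δ : ℝ) (n : ℕ) : Prop :=
  ∀ d : ℕ, (d : ℝ) ≤ logb 2 (logb 2 (Nat.card V)) - 1 →
    ∀ S : Set V, (S.ncard : ℝ) ≤ (Nat.card V : ℝ) / (2 : ℝ) ^ (2 ^ d : ℕ) →
      ((nbhd G S).ncard : ℝ) ≥ δ * 2 ^ d / logb 2 n * S.ncard

/-- `B_k(v)`: ball of radius `k` around the vertex `v`. -/
def gball {V : Type*} (G : SimpleGraph V) (v : V) (k : ℕ) : Set V :=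
  {u | ∃ p : G.Walk v u, p.length ≤ k}

/-- `B_k(U)`: ball of radius `k` around the vertex set `U`. -/
def gballSet {V : Type*} (G : SimpleGraph V) (U : Set V) (k : ℕ) : Set V :=
  {v | ∃ u ∈ U, ∃ p : G.Walk u v, p.length ≤ k}

/-- A graph `H` is a `γ`-expanding ball: it is covered by a ball `B_k(v)` all of whose
intermediate balls expand by a factor `1 + γ`. -/
def GraphIsExpandingBall {V : Type*} (H : SimpleGraph V) (γ : ℝ) : Prop :=
  ∃ (v : V) (k : ℕ), gball H v k = Set.univ ∧
    ∀ i : ℕ, 1 ≤ i → i + 1 ≤ k →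
      ((gball H v (i + 1)).ncard : ℝ) ≥ (1 + γ) * (gball H v i).ncard

section ExpanderMinors

open Finset
open scoped Classical

variable {V : Type*}

/-- The finite set `P` induces a connected subgraph of `G`. -/
def ConnOn (G : SimpleGraph V) (P : Finset V) : Prop :=
  (G.induce (P : Set V)).Connected

lemma connOn_singleton (G : SimpleGraph V) (v : V) : ConnOn G {v} := by
  unfold ConnOn
  rw [Finset.coe_singleton]
  have : Subsingleton ({v} : Set V) := by infer_instance
  exact ⟨fun a b => by rw [Subsingleton.elim a b]⟩

lemma ConnOn.nonempty {G : SimpleGraph V} {P : Finset V} (h : ConnOn G P) : P.Nonempty := by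
  obtain ⟨v⟩ := SimpleGraph.Connected.nonempty h
  exact ⟨v.1, v.2⟩

lemma ConnOn.union {G : SimpleGraph V} {P Q : Finset V} (hP : ConnOn G P) (hQ : ConnOn G Q)
    {v : V} (hvP : v ∈ P) (hvQ : v ∈ Q) : ConnOn G (P ∪ Q) := by
  unfold ConnOn
  rw [Finset.coe_union]
  exact SimpleGraph.induce_union_connected hP.preconnected hQ.preconnected ⟨v, hvP, hvQ⟩

lemma ConnOn.insert {G : SimpleGraph V} {P : Finset V} (hP : ConnOn G P)
    {u v : V} (hu : u ∈ P) (huv : G.Adj u v) : ConnOn G (insert v P) := by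
  have h : ConnOn G ({v} ∪ P) := by
    unfold ConnOn
    rw [Finset.coe_union]
    exact SimpleGraph.connected_induce_union (connOn_singleton G v).preconnected hP.preconnected
      (by simp) (by simpa using hu) huv.symm
  rwa [Finset.insert_eq]

lemma connOn_biUnion {ι : Type*} {G : SimpleGraph V} {s : Finset ι} {P : ι → Finset V}
    (hs : s.Nonempty) {v : V} (hP : ∀ i ∈ s, ConnOn G (P i)) (hv : ∀ i ∈ s, v ∈ P i) :
    ConnOn G (s.biUnion P) := by
  induction hs using Finset.Nonempty.cons_induction with
  | singleton a => simpa using hP a (by simp)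
  | cons a s ha hs ih =>
    rw [Finset.cons_eq_insert, Finset.biUnion_insert]
    obtain ⟨b, hb⟩ := hs
    exact (hP a (by simp)).union
      (ih (fun i hi => hP i (by simp [hi])) (fun i hi => hv i (by simp [hi])))
      (hv a (by simp)) (Finset.mem_biUnion.2 ⟨b, hb, hv b (by simp [hb])⟩)

/-- A connected set has an edge leaving each proper nonempty subset. -/
lemma ConnOn.exists_adj_of_ssubset {G : SimpleGraph V} {B S : Finset V} (hB : ConnOn G B)
    (hS : S.Nonempty) (hSB : S ⊂ B) : ∃ u ∈ S, ∃ w ∈ B, w ∉ S ∧ G.Adj u w := by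
  by_contra! hcon
  obtain ⟨u, hu⟩ := hS
  obtain ⟨w, hwB, hwS⟩ := Finset.exists_of_ssubset hSB
  obtain ⟨p⟩ := hB.preconnected ⟨u, hSB.1 hu⟩ ⟨w, hwB⟩
  have key : ∀ (a b : (B : Set V)), (G.induce (B : Set V)).Walk a b →
      (a : V) ∈ S → (b : V) ∈ S := by
    intro a b q
    induction q with
    | nil => exact id
    | cons hadj _ ih =>
      intro ha
      apply ih
      by_contra hb
      exact hcon _ ha _ (Subtype.prop _) hb hadj
  exact hwS (key _ _ p hu)

/-- Cutting a connected set `B` at its first meeting with `A`. -/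
lemma ConnOn.exists_part_touching {G : SimpleGraph V} {A B : Finset V} (hB : ConnOn G B) {u : V}
    (huB : u ∈ B) (huA : u ∉ A) (hAB : (A ∩ B).Nonempty) :
    ∃ B' ⊆ B, ConnOn G B' ∧ u ∈ B' ∧ Disjoint B' A ∧ ∃ b ∈ B', ∃ a ∈ A, G.Adj b a := by
  have hne : (B.powerset.filter (fun X => ConnOn G X ∧ u ∈ X ∧ Disjoint X A)).Nonempty :=
    ⟨{u}, by simp [huB, huA, connOn_singleton]⟩
  obtain ⟨B', hB', hmax⟩ := Finset.exists_max_image _ Finset.card hne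
  simp only [Finset.mem_filter, Finset.mem_powerset] at hB' hmax
  obtain ⟨hsub, hconn, huB', hdisj⟩ := hB'
  refine ⟨B', hsub, hconn, huB', hdisj, ?_⟩
  have hss : B' ⊂ B := by
    refine Finset.ssubset_iff_subset_ne.2 ⟨hsub, ?_⟩
    rintro rfl
    obtain ⟨z, hz⟩ := hAB
    rw [Finset.mem_inter] at hz
    exact Finset.disjoint_left.1 hdisj hz.2 hz.1
  obtain ⟨b, hb, w, hwB, hwB', hadj⟩ := hB.exists_adj_of_ssubset ⟨u, huB'⟩ hss
  refine ⟨b, hb, w, ?_, hadj⟩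
  by_contra hwA
  have := hmax (Insert.insert w B') ⟨Finset.insert_subset hwB hsub, hconn.insert hb hadj,
    by simp [huB'], by simp [hwA, hdisj]⟩
  rw [Finset.card_insert_of_notMem hwB'] at this
  omega

/-- The number of `j ∈ F` for which `z` lies in `P j`. -/
noncomputable def congestion {J : Type*} (F : Finset J) (P : J → Finset V) (z : V) : ℕ :=
  #{j ∈ F | z ∈ P j}

lemma congestion_insert_update {J : Type*} {F : Finset J} {P : J → Finset V} {j : J} (hj : j ∉ F)
    (Q : Finset V) (z : V) :
    congestion (insert j F) (Function.update P j Q) z =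
      congestion F P z + if z ∈ Q then 1 else 0 := by
  unfold congestion
  simp only [Finset.card_filter]
  rw [Finset.sum_insert hj, add_comm]
  congr 1
  · refine Finset.sum_congr rfl fun i hi => ?_
    rw [Function.update_of_ne (by rintro rfl; exact hj hi)]
  · simp

variable [Fintype V]

/-- The finite set of vertices outside `S` with a neighbour in `S`. -/
noncomputable def extNbhd (G : SimpleGraph V) (S : Finset V) : Finset V :=
  univ.filter fun v => v ∉ S ∧ ∃ u ∈ S, G.Adj u v

lemma mem_extNbhd {G : SimpleGraph V} {S : Finset V} {v : V} :
    v ∈ extNbhd G S ↔ v ∉ S ∧ ∃ u ∈ S, G.Adj u v := by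
  simp [extNbhd]

/-- The set of vertices reached from `S` in at most `k` steps whose vertices avoid `W`. -/
noncomputable def reach (G : SimpleGraph V) (W S : Finset V) : ℕ → Finset V
  | 0 => S
  | k + 1 => reach G W S k ∪ (extNbhd G (reach G W S k) \ W)

lemma reach_subset_succ (G : SimpleGraph V) (W S : Finset V) (k : ℕ) :
    reach G W S k ⊆ reach G W S (k + 1) :=
  Finset.subset_union_left

lemma reach_mono (G : SimpleGraph V) (W S : Finset V) : Monotone (reach G W S) :=
  monotone_nat_of_le_succ (reach_subset_succ G W S)

lemma mem_reach_succ {G : SimpleGraph V} {W S : Finset V} {k : ℕ} {v : V} :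
    v ∈ reach G W S (k + 1) ↔
      v ∈ reach G W S k ∨ (v ∉ W ∧ v ∉ reach G W S k ∧ ∃ u ∈ reach G W S k, G.Adj u v) := by
  simp only [reach, Finset.mem_union, Finset.mem_sdiff, mem_extNbhd]
  tauto

lemma disjoint_reach {G : SimpleGraph V} {W S : Finset V} (h : Disjoint S W) (k : ℕ) :
    Disjoint (reach G W S k) W := by
  induction k with
  | zero => exact h
  | succ k ih => exact Finset.disjoint_union_left.2 ⟨ih, Finset.sdiff_disjoint⟩

lemma exists_mem_reach_singleton {G : SimpleGraph V} {W S : Finset V} {k : ℕ} {v : V}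
    (hv : v ∈ reach G W S k) : ∃ s ∈ S, v ∈ reach G W {s} k := by
  induction k generalizing v with
  | zero => exact ⟨v, hv, by simp [reach]⟩
  | succ k ih =>
    rw [mem_reach_succ] at hv
    rcases hv with hv | ⟨hvW, -, u, hu, huv⟩
    · obtain ⟨s, hs, h⟩ := ih hv
      exact ⟨s, hs, reach_subset_succ _ _ _ _ h⟩
    · obtain ⟨s, hs, h⟩ := ih hu
      refine ⟨s, hs, ?_⟩
      rw [mem_reach_succ]
      by_cases hv' : v ∈ reach G W {s} k
      · exact Or.inl hv'
      · exact Or.inr ⟨hvW, hv', u, h, huv⟩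

lemma exists_connOn_of_mem_reach {G : SimpleGraph V} {W : Finset V} {s v : V} {k : ℕ}
    (hv : v ∈ reach G W {s} k) :
    ∃ P ⊆ reach G W {s} k, ConnOn G P ∧ s ∈ P ∧ v ∈ P ∧ #P ≤ k + 1 := by
  induction k generalizing v with
  | zero =>
    have : v = s := by simpa [reach] using hv
    subst this
    exact ⟨{v}, by simp [reach], connOn_singleton G v, by simp, by simp, by simp⟩
  | succ k ih =>
    by_cases hv' : v ∈ reach G W {s} k
    · obtain ⟨P, hP, h1, h2, h3, h4⟩ := ih hv'
      exact ⟨P, hP.trans (reach_subset_succ _ _ _ _), h1, h2, h3, by omega⟩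
    · have hv2 := hv
      rw [mem_reach_succ] at hv
      rcases hv with hv | ⟨hvW, -, u, hu, huv⟩
      · exact absurd hv hv'
      obtain ⟨P, hP, h1, h2, h3, h4⟩ := ih hu
      exact ⟨insert v P, Finset.insert_subset hv2 (hP.trans (reach_subset_succ _ _ _ _)),
        h1.insert h3 huv, by simp [h2], by simp, (Finset.card_insert_le _ _).trans (by omega)⟩

/-- A set `C` each of whose vertices is joined to `v` by a connected subset of `C` with at most
`k` vertices. -/
def IsCore (G : SimpleGraph V) (k : ℕ) (v : V) (C : Finset V) : Prop :=
  v ∈ C ∧ ∀ z ∈ C, ∃ P ⊆ C, ConnOn G P ∧ v ∈ P ∧ z ∈ P ∧ #P ≤ k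

lemma exists_core_card_eq {G : SimpleGraph V} {W : Finset V} {s : V} {k q : ℕ} (hq : 1 ≤ q)
    (hk : q ≤ #(reach G W {s} k)) :
    ∃ C ⊆ reach G W {s} k, #C = q ∧ IsCore G (k + 1) s C := by
  induction k with
  | zero =>
    have : q = 1 := by
      simp only [reach, Finset.card_singleton] at hk
      omega
    subst this
    refine ⟨{s}, by simp [reach], by simp, by simp, fun z hz => ?_⟩
    have : z = s := by simpa using hz
    subst this
    exact ⟨{z}, by simp, connOn_singleton G z, by simp, by simp, by simp⟩
  | succ k ih =>
    by_cases h : q ≤ #(reach G W {s} k)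
    · obtain ⟨C, hC, h1, h2, h3⟩ := ih h
      refine ⟨C, hC.trans (reach_subset_succ _ _ _ _), h1, h2, fun z hz => ?_⟩
      obtain ⟨P, hP, h4, h5, h6, h7⟩ := h3 z hz
      exact ⟨P, hP, h4, h5, h6, by omega⟩
    · obtain ⟨C, hC1, hC2, hC3⟩ :=
        Finset.exists_subsuperset_card_eq (reach_subset_succ G W {s} k) (by omega) hk
      have hs : s ∈ reach G W {s} k := reach_mono G W {s} (Nat.zero_le k) (by simp [reach])
      refine ⟨C, hC2, hC3, hC1 hs, fun z hz => ?_⟩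
      by_cases hz' : z ∈ reach G W {s} k
      · obtain ⟨P, hP, h1, h2, h3, h4⟩ := exists_connOn_of_mem_reach hz'
        exact ⟨P, hP.trans hC1, h1, h2, h3, by omega⟩
      · rcases mem_reach_succ.1 (hC2 hz) with h' | ⟨-, -, u, hu, huz⟩
        · exact absurd h' hz'
        obtain ⟨P, hP, h1, h2, h3, h4⟩ := exists_connOn_of_mem_reach hu
        exact ⟨insert z P, Finset.insert_subset hz (hP.trans hC1), h1.insert h3 huz,
          by simp [h2], by simp, (Finset.card_insert_le _ _).trans (by omega)⟩

/-- Every set of at most `|V| / x` vertices has at least `ρ` times as many external neighbours. -/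
def ExpandsUpTo (G : SimpleGraph V) (x : ℕ) (ρ : ℝ) : Prop :=
  ∀ S : Finset V, #S * x ≤ Fintype.card V → ρ * #S ≤ #(extNbhd G S)

lemma card_reach_of_expands {G : SimpleGraph V} {x : ℕ} {ρ : ℝ} (hG : ExpandsUpTo G x ρ)
    (hx : 2 ≤ x) (hρ : 0 < ρ) {R : ℕ} (hR : (Fintype.card V : ℝ) ≤ (1 + ρ / 2) ^ R)
    {W S : Finset V} (hS : S.Nonempty) (hW : (#W : ℝ) ≤ ρ / 2 * #S) :
    Fintype.card V < #(reach G W S R) * x := by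
  by_contra! hcon
  have hgrow : ∀ j ≤ R, (1 + ρ / 2) ^ j * #S ≤ #(reach G W S j) := by
    intro j
    induction j with
    | zero => intro _; simp [reach]
    | succ j ih =>
      intro hj
      have h1 := ih (by omega)
      have hle : #(reach G W S j) ≤ #(reach G W S R) :=
        Finset.card_le_card (reach_mono G W S (by omega))
      have h2 := hG (reach G W S j) ((Nat.mul_le_mul_right x hle).trans hcon)
      have h3 : #(reach G W S j) + #(extNbhd G (reach G W S j)) ≤ #(reach G W S (j + 1)) + #W := by
        have hd : Disjoint (reach G W S j) (extNbhd G (reach G W S j) \ W) := by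
          rw [Finset.disjoint_left]
          intro v hv hv'
          exact (mem_extNbhd.1 (Finset.mem_sdiff.1 hv').1).1 hv
        have h4 : #(reach G W S (j + 1)) = #(reach G W S j) + #(extNbhd G (reach G W S j) \ W) :=
          Finset.card_union_of_disjoint hd
        have h5 := Finset.le_card_sdiff W (extNbhd G (reach G W S j))
        omega
      have h3' : (#(reach G W S j) : ℝ) + #(extNbhd G (reach G W S j)) ≤
          #(reach G W S (j + 1)) + #W := by exact_mod_cast h3
      have h6 : (#S : ℝ) ≤ #(reach G W S j) := by
        exact_mod_cast Finset.card_le_card (reach_mono G W S (Nat.zero_le j))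
      have h7 : ρ / 2 * #S ≤ ρ / 2 * #(reach G W S j) := by gcongr
      calc (1 + ρ / 2) ^ (j + 1) * #S = (1 + ρ / 2) * ((1 + ρ / 2) ^ j * #S) := by ring
        _ ≤ (1 + ρ / 2) * #(reach G W S j) := by gcongr
        _ ≤ _ := by linarith
  have h1 := hgrow R le_rfl
  have h2 : (1 : ℝ) ≤ #S := by exact_mod_cast hS.card_pos
  have h3 : (Fintype.card V : ℝ) ≤ #(reach G W S R) := by
    calc (Fintype.card V : ℝ) ≤ (1 + ρ / 2) ^ R * 1 := by linarith
      _ ≤ (1 + ρ / 2) ^ R * #S := by gcongr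
      _ ≤ _ := h1
  have h4 : Fintype.card V ≤ #(reach G W S R) := by exact_mod_cast h3
  have h5 : 0 < Fintype.card V := by
    obtain ⟨v, -⟩ := hS
    exact Fintype.card_pos_iff.2 ⟨v⟩
  nlinarith

lemma exists_core_avoiding {G : SimpleGraph V} {x : ℕ} {ρ : ℝ} (hG : ExpandsUpTo G x ρ)
    (hx : 2 ≤ x) (hρ : 0 < ρ) {R : ℕ} (hR : (Fintype.card V : ℝ) ≤ (1 + ρ / 2) ^ R)
    {W : Finset V} {s q : ℕ} (hq : 1 ≤ q) (hs : 1 ≤ s) (hcard : s + #W ≤ Fintype.card V)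
    (hW : (#W : ℝ) ≤ ρ / 2 * s) (hqs : q * s * x ≤ Fintype.card V) :
    ∃ v C, #C = q ∧ Disjoint C W ∧ IsCore G (R + 1) v C := by
  obtain ⟨S, hSW, hS⟩ : ∃ S ⊆ univ \ W, #S = s := by
    refine Finset.exists_subset_card_eq ?_
    rw [Finset.card_sdiff_of_subset (Finset.subset_univ W), Finset.card_univ]
    omega
  have hdisj : Disjoint S W := Finset.disjoint_of_subset_left hSW Finset.sdiff_disjoint
  have hne : S.Nonempty := Finset.card_pos.1 (by omega)
  have h1 := card_reach_of_expands hG hx hρ hR hne (W := W) (by rw [hS]; exact hW)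
  obtain ⟨v, hv, hvq⟩ : ∃ v ∈ S, q ≤ #(reach G W {v} R) := by
    by_contra! hcon
    have h2 : reach G W S R ⊆ S.biUnion fun v => reach G W {v} R := by
      intro z hz
      obtain ⟨v, hv, hz'⟩ := exists_mem_reach_singleton hz
      exact Finset.mem_biUnion.2 ⟨v, hv, hz'⟩
    have h3 : #(reach G W S R) ≤ s * q := by
      rw [← hS]
      exact (Finset.card_le_card h2).trans
        (Finset.card_biUnion_le_card_mul _ _ _ fun v hv => (hcon v hv).le)
    have h4 := Nat.mul_le_mul_right x h3
    rw [mul_comm s q] at h4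
    omega
  obtain ⟨C, hC, hCq, hcore⟩ := exists_core_card_eq hq hvq
  refine ⟨v, C, hCq, Finset.disjoint_of_subset_left hC (disjoint_reach ?_ R), hcore⟩
  exact Finset.disjoint_of_subset_left (by simpa using hv) hdisj

lemma exists_disjoint_cores {G : SimpleGraph V} {x : ℕ} {ρ : ℝ} (hG : ExpandsUpTo G x ρ)
    (hx : 2 ≤ x) (hρ : 0 < ρ) {R : ℕ} (hR : (Fintype.card V : ℝ) ≤ (1 + ρ / 2) ^ R)
    {s q M : ℕ} (hq : 1 ≤ q) (hs : 1 ≤ s) (hcard : s + M * q ≤ Fintype.card V)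
    (hW : ((M * q : ℕ) : ℝ) ≤ ρ / 2 * s) (hqs : q * s * x ≤ Fintype.card V) :
    ∃ (v : Fin M → V) (C : Fin M → Finset V), (∀ i, #(C i) = q ∧ IsCore G (R + 1) (v i) (C i)) ∧
      Pairwise (Function.onFun Disjoint C) := by
  have key : ∀ j ≤ M, ∃ 𝒞 : Finset (V × Finset V), #𝒞 = j ∧
      (∀ c ∈ 𝒞, #c.2 = q ∧ IsCore G (R + 1) c.1 c.2) ∧
      ∀ c ∈ 𝒞, ∀ c' ∈ 𝒞, c ≠ c' → Disjoint c.2 c'.2 := by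
    intro j
    induction j with
    | zero => intro _; exact ⟨∅, by simp⟩
    | succ j ih =>
      intro hj
      obtain ⟨𝒞, h1, h2, h3⟩ := ih (by omega)
      have h4 : #(𝒞.biUnion Prod.snd) ≤ M * q :=
        (Finset.card_biUnion_le_card_mul _ _ q fun c hc => (h2 c hc).1.le).trans
          (Nat.mul_le_mul_right q (by omega))
      obtain ⟨v, C, hC, hd, hcore⟩ := exists_core_avoiding hG hx hρ hR
        (W := 𝒞.biUnion Prod.snd) hq hs (by omega)
        ((Nat.cast_le.2 h4).trans hW) hqs
      rw [Finset.disjoint_biUnion_right] at hd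
      have hnot : (v, C) ∉ 𝒞 := by
        intro hmem
        have := hd _ hmem
        simp only [disjoint_self, Finset.bot_eq_empty] at this
        rw [this] at hC
        simp at hC
        omega
      refine ⟨insert (v, C) 𝒞, by rw [Finset.card_insert_of_notMem hnot, h1], ?_, ?_⟩
      · intro c hc
        rcases Finset.mem_insert.1 hc with rfl | hc
        · exact ⟨hC, hcore⟩
        · exact h2 c hc
      · intro c hc c' hc' hne
        rcases Finset.mem_insert.1 hc with rfl | hc <;> rcases Finset.mem_insert.1 hc' with rfl | hc'
        · exact absurd rfl hne
        · exact hd _ hc'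
        · exact (hd _ hc).symm
        · exact h3 c hc c' hc' hne
  obtain ⟨𝒞, h1, h2, h3⟩ := key M le_rfl
  let φ := (𝒞.equivFinOfCardEq h1).symm
  refine ⟨fun i => (φ i).1.1, fun i => (φ i).1.2, fun i => h2 _ (φ i).2, fun i j hij => ?_⟩
  exact h3 _ (φ i).2 _ (φ j).2 fun h => hij (φ.injective (Subtype.ext h))

/-- The set `Q` is connected, has at most `k` vertices and contains both `v` and `z`. -/
def Links (G : SimpleGraph V) (k : ℕ) (v z : V) (Q : Finset V) : Prop :=
  ConnOn G Q ∧ v ∈ Q ∧ z ∈ Q ∧ #Q ≤ k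

lemma card_linked_avoiding {G : SimpleGraph V} {x : ℕ} {ρ : ℝ} (hG : ExpandsUpTo G x ρ)
    (hx : 2 ≤ x) (hρ : 0 < ρ) {R : ℕ} (hR : (Fintype.card V : ℝ) ≤ (1 + ρ / 2) ^ R)
    {q M : ℕ} (hq : 1 ≤ q) {v : Fin M → V} {C : Fin M → Finset V}
    (hC : ∀ i, #(C i) = q ∧ IsCore G (R + 1) (v i) (C i))
    (hdisj : Pairwise (Function.onFun Disjoint C)) {W : Finset V} (hW : (#W : ℝ) ≤ ρ / 2 * q) :
    (M - #W) * Fintype.card V ≤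
      x * #{j : Fin M × V | ∃ Q, Links G (2 * R + 2) (v j.1) j.2 Q ∧ Disjoint Q W} := by
  set I : Finset (Fin M) := univ.filter fun i => Disjoint (C i) W with hI
  have hIcard : M - #W ≤ #I := by
    have h1 : #(univ \ I) ≤ #W := by
      refine Finset.card_le_card_of_forall_subsingleton (fun i z => z ∈ C i) ?_ ?_
      · intro i hi
        obtain ⟨z, hz, hzW⟩ : ∃ z, z ∈ C i ∧ z ∈ W := by
          simpa [hI, Finset.not_disjoint_iff] using hi
        exact ⟨z, hzW, hz⟩
      · intro z _ i hi j hj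
        by_contra hij
        exact Finset.disjoint_left.1 (hdisj hij) hi.2 hj.2
    rw [Finset.card_sdiff_of_subset (Finset.subset_univ I), Finset.card_univ,
      Fintype.card_fin] at h1
    omega
  have hsig : #(I.sigma fun i => reach G W (C i) R) ≤
      #{j : Fin M × V | ∃ Q, Links G (2 * R + 2) (v j.1) j.2 Q ∧ Disjoint Q W} := by
    refine Finset.card_le_card_of_injOn (fun p => (p.1, p.2)) ?_ ?_
    · rintro ⟨i, z⟩ hp
      simp only [Finset.coe_sigma, Set.mem_sigma_iff, Finset.mem_coe, hI, Finset.mem_filter,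
        Finset.mem_univ, true_and] at hp
      obtain ⟨hi, hz⟩ := hp
      obtain ⟨s, hs, hz'⟩ := exists_mem_reach_singleton hz
      obtain ⟨P, hP, h1, h2, h3, h4⟩ := exists_connOn_of_mem_reach hz'
      obtain ⟨P', hP', h1', h2', h3', h4'⟩ := (hC i).2.2 s hs
      simp only [Finset.coe_filter, Finset.mem_univ, true_and, Set.mem_ofPred_eq]
      refine ⟨P' ∪ P, ⟨h1'.union h1 h3' h2, by simp [h2'], by simp [h3],
        (Finset.card_union_le _ _).trans (by omega)⟩, ?_⟩
      refine Finset.disjoint_union_left.2 ⟨Finset.disjoint_of_subset_left hP' hi,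
        Finset.disjoint_of_subset_left hP (disjoint_reach ?_ R)⟩
      exact Finset.disjoint_of_subset_left (by simpa using hs) hi
    · rintro ⟨i, z⟩ _ ⟨j, z'⟩ _ h
      simp only [Prod.mk.injEq] at h
      obtain ⟨rfl, rfl⟩ := h
      rfl
  rw [Finset.card_sigma] at hsig
  calc (M - #W) * Fintype.card V ≤ #I * Fintype.card V := by gcongr
    _ = ∑ _i ∈ I, Fintype.card V := by simp
    _ ≤ ∑ i ∈ I, x * #(reach G W (C i) R) := by
        refine Finset.sum_le_sum fun i _ => ?_
        rw [mul_comm]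
        refine (card_reach_of_expands hG hx hρ hR ?_ ?_).le
        · exact Finset.card_pos.1 (by rw [(hC i).1]; omega)
        · rw [(hC i).1]; exact hW
    _ = x * ∑ i ∈ I, #(reach G W (C i) R) := by rw [Finset.mul_sum]
    _ ≤ _ := by gcongr

lemma sum_congestion_mul {J : Type*} (F : Finset J) (P : J → Finset V) (f : V → ℕ) :
    ∑ z, congestion F P z * f z = ∑ j ∈ F, ∑ z ∈ P j, f z := by
  simp only [congestion, Finset.card_filter, Finset.sum_mul]
  rw [Finset.sum_comm]
  refine Finset.sum_congr rfl fun j _ => ?_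
  simp [Finset.sum_ite_mem]

/-- If after deleting any `w` vertices at least `e` indices still have an allowed set, then some
`e` indices have allowed sets that overlap little. -/
lemma exists_low_congestion {J : Type*} [Fintype J] (Allowed : J → Finset V → Prop)
    {k h w e : ℕ} (hk : ∀ j Q, Allowed j Q → #Q ≤ k) (hh : 0 < h)
    (hJ : Fintype.card J * k ≤ w * h)
    (hav : ∀ W : Finset V, #W ≤ w → e ≤ #{j | ∃ Q, Allowed j Q ∧ Disjoint Q W}) :
    ∃ (F : Finset J) (P : J → Finset V), #F = e ∧ (∀ j ∈ F, Allowed j (P j)) ∧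
      ∑ z, congestion F P z ^ 2 ≤ e * (k * (2 * h + 1)) := by
  have hne : (univ.filter fun S : Finset J × (J → Finset V) =>
      #S.1 = e ∧ ∀ j ∈ S.1, Allowed j (S.2 j)).Nonempty := by
    obtain ⟨F, hF, hFe⟩ := Finset.exists_subset_card_eq (hav ∅ (by simp))
    have hch : ∀ j, ∃ Q, j ∈ F → Allowed j Q := by
      intro j
      by_cases hj : j ∈ F
      · obtain ⟨Q, hQ, -⟩ := (Finset.mem_filter.1 (hF hj)).2
        exact ⟨Q, fun _ => hQ⟩
      · exact ⟨∅, fun h => absurd h hj⟩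
    choose P hP using hch
    exact ⟨(F, P), by simpa [hFe] using hP⟩
  obtain ⟨⟨F, P⟩, hFP, hmin⟩ :=
    Finset.exists_min_image _ (fun S => ∑ z, congestion S.1 S.2 z ^ 2) hne
  simp only [Finset.mem_filter, Finset.mem_univ, true_and, Prod.forall] at hFP hmin
  obtain ⟨hFe, hall⟩ := hFP
  refine ⟨F, P, hFe, hall, ?_⟩
  set W : Finset V := univ.filter fun z => h ≤ congestion F P z with hWdef
  have hW : #W ≤ w := by
    have h1 : #W * h ≤ ∑ z, congestion F P z * 1 := by
      calc #W * h = ∑ _z ∈ W, h := by simp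
        _ ≤ ∑ z ∈ W, congestion F P z * 1 := by
            refine Finset.sum_le_sum fun z hz => ?_
            simpa using (Finset.mem_filter.1 hz).2
        _ ≤ _ := Finset.sum_le_sum_of_subset (Finset.subset_univ _)
    rw [sum_congestion_mul] at h1
    have h2 : ∑ j ∈ F, ∑ z ∈ P j, 1 ≤ Fintype.card J * k := by
      calc ∑ j ∈ F, ∑ z ∈ P j, 1 ≤ ∑ _j ∈ F, k := by
            refine Finset.sum_le_sum fun j hj => ?_
            simpa using hk j _ (hall j hj)
        _ = #F * k := by simp
        _ ≤ _ := by gcongr; exact Finset.card_le_univ F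
    exact Nat.le_of_mul_le_mul_right (h1.trans (h2.trans hJ)) hh
  have hcost : ∀ j ∈ F, ∑ z ∈ P j, congestion F P z ≤ k * (2 * h + 1) := by
    intro j hj
    obtain ⟨i, hi, hiF⟩ : ∃ i ∈ (univ.filter fun j => ∃ Q, Allowed j Q ∧ Disjoint Q W),
        i ∉ F.erase j := by
      refine Finset.exists_mem_notMem_of_card_lt_card ?_
      have h1 := hav W hW
      rw [Finset.card_erase_of_mem hj]
      have : 0 < #F := Finset.card_pos.2 ⟨j, hj⟩
      omega
    obtain ⟨Q, hQ, hQW⟩ := (Finset.mem_filter.1 hi).2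
    have hm := hmin (insert i (F.erase j)) (Function.update P i Q)
      (by
        constructor
        · have : 0 < #F := Finset.card_pos.2 ⟨j, hj⟩
          rw [Finset.card_insert_of_notMem hiF, Finset.card_erase_of_mem hj]
          omega
        · intro l hl
          by_cases hli : l = i
          · subst hli; simpa using hQ
          · rw [Function.update_of_ne hli]
            exact hall l (Finset.mem_of_mem_erase ((Finset.mem_insert.1 hl).resolve_left hli)))
    simp only [congestion_insert_update hiF] at hm
    have hC : ∀ z, congestion F P z = congestion (F.erase j) P z + if z ∈ P j then 1 else 0 := by
      intro z
      have := congestion_insert_update (P := P) (Finset.notMem_erase j F) (P j) z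
      rwa [Finset.insert_erase hj, Function.update_eq_self] at this
    have h1 : ∑ z ∈ P j, congestion F P z + ∑ z, congestion (F.erase j) P z ^ 2 ≤
        ∑ z, congestion F P z ^ 2 := by
      have : ∑ z ∈ P j, congestion F P z = ∑ z, if z ∈ P j then congestion F P z else 0 := by
        simp [Finset.sum_ite_mem]
      rw [this, ← Finset.sum_add_distrib]
      refine Finset.sum_le_sum fun z _ => ?_
      rw [hC z]
      split_ifs <;> nlinarith
    have h2 : ∑ z, (congestion (F.erase j) P z + if z ∈ Q then 1 else 0) ^ 2 ≤
        ∑ z, congestion (F.erase j) P z ^ 2 + k * (2 * h + 1) := by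
      have h3 : ∑ z, (congestion (F.erase j) P z + if z ∈ Q then 1 else 0) ^ 2 =
          ∑ z, congestion (F.erase j) P z ^ 2 +
            ∑ z ∈ Q, (2 * congestion (F.erase j) P z + 1) := by
        have : ∑ z ∈ Q, (2 * congestion (F.erase j) P z + 1) =
            ∑ z, if z ∈ Q then 2 * congestion (F.erase j) P z + 1 else 0 := by
          simp [Finset.sum_ite_mem]
        rw [this, ← Finset.sum_add_distrib]
        refine Finset.sum_congr rfl fun z _ => ?_
        split_ifs <;> ring
      rw [h3]
      gcongr
      calc ∑ z ∈ Q, (2 * congestion (F.erase j) P z + 1) ≤ ∑ _z ∈ Q, (2 * h + 1) := by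
            refine Finset.sum_le_sum fun z hz => ?_
            have hzW : z ∉ W := Finset.disjoint_left.1 hQW hz
            simp only [hWdef, Finset.mem_filter, Finset.mem_univ, true_and, not_le] at hzW
            have := hC z
            omega
        _ = #Q * (2 * h + 1) := by simp
        _ ≤ _ := by gcongr; exact hk i Q hQ
    omega
  calc ∑ z, congestion F P z ^ 2 = ∑ z, congestion F P z * congestion F P z := by
        simp only [sq]
    _ = ∑ j ∈ F, ∑ z ∈ P j, congestion F P z := sum_congestion_mul F P _
    _ ≤ ∑ _j ∈ F, k * (2 * h + 1) := Finset.sum_le_sum hcost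
    _ = e * (k * (2 * h + 1)) := by simp [hFe]

lemma card_mul_pow_sum_le {ι : Type*} [Fintype ι] (f : ι → ℕ) (n : ℕ) :
    Fintype.card ι * (∑ i, f i) ^ n ≤ Fintype.card ι ^ n * ∑ i, f i ^ n := by
  cases n with
  | zero => simp
  | succ n =>
    have h := pow_sum_le_card_mul_sum_pow (s := univ) (f := f) (fun i _ => Nat.zero_le _) n
    rw [pow_succ' (Fintype.card ι), mul_assoc]
    exact Nat.mul_le_mul_left _ h

/-- A dense bipartite graph has many homomorphic copies of a complete bipartite graph. -/
lemma card_complete_bipartite_hom {I X α β : Type*} [Fintype I] [Fintype X] [Fintype α]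
    [Fintype β] (F : Finset (I × X)) :
    #F ^ (Fintype.card α * Fintype.card β) *
        (Fintype.card I ^ Fintype.card α * Fintype.card X ^ Fintype.card β) ≤
      (Fintype.card I * Fintype.card X) ^ (Fintype.card α * Fintype.card β) *
        #{p : (α → I) × (β → X) | ∀ i e, (p.1 i, p.2 e) ∈ F} := by
  set A := Fintype.card α
  set B := Fintype.card β
  set good := #{p : (α → I) × (β → X) | ∀ i e, (p.1 i, p.2 e) ∈ F} with hgood
  set T := ∑ x : X, #{i | (i, x) ∈ F} ^ A with hT
  have hF : ∑ x : X, #{i | (i, x) ∈ F} = #F := by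
    simp only [Finset.card_filter]
    rw [Finset.sum_comm, ← Finset.sum_product', ← Finset.card_filter]
    simp
  have hT' : T = ∑ a : α → I, #{x | ∀ i, (a i, x) ∈ F} := by
    have h1 : ∀ x : X, #{i | (i, x) ∈ F} ^ A = #{a : α → I | ∀ i, (a i, x) ∈ F} := by
      intro x
      rw [show A = #(univ : Finset α) from rfl, ← Finset.prod_const, ← Fintype.card_piFinset]
      congr 1
      ext a
      simp
    simp only [hT, h1]
    simp only [Finset.card_filter]
    rw [Finset.sum_comm]
  have hg : good = ∑ a : α → I, #{x | ∀ i, (a i, x) ∈ F} ^ B := by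
    have h1 : ∀ a : α → I, #{x | ∀ i, (a i, x) ∈ F} ^ B =
        #{b : β → X | ∀ i e, (a i, b e) ∈ F} := by
      intro a
      rw [show B = #(univ : Finset β) from rfl, ← Finset.prod_const, ← Fintype.card_piFinset]
      congr 1
      ext b
      simp only [Fintype.mem_piFinset, Finset.mem_filter, Finset.mem_univ, true_and]
      exact forall_comm
    simp only [hgood, h1]
    simp only [Finset.card_filter]
    rw [← Finset.univ_product_univ, Finset.sum_product]
  have h1 : Fintype.card X * #F ^ A ≤ Fintype.card X ^ A * T := by
    rw [← hF]
    exact card_mul_pow_sum_le _ _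
  have h2 : Fintype.card I ^ A * T ^ B ≤ (Fintype.card I ^ A) ^ B * good := by
    rw [hT', hg]
    have := card_mul_pow_sum_le (fun a : α → I => #{x | ∀ i, (a i, x) ∈ F}) B
    rwa [Fintype.card_fun] at this
  calc #F ^ (A * B) * (Fintype.card I ^ A * Fintype.card X ^ B)
      = Fintype.card I ^ A * (Fintype.card X * #F ^ A) ^ B := by ring
    _ ≤ Fintype.card I ^ A * (Fintype.card X ^ A * T) ^ B := by gcongr
    _ = (Fintype.card X ^ A) ^ B * (Fintype.card I ^ A * T ^ B) := by ring
    _ ≤ (Fintype.card X ^ A) ^ B * ((Fintype.card I ^ A) ^ B * good) := by gcongr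
    _ = _ := by ring

lemma card_overlapping_le {J : Type*} (F : Finset J) (P : J → Finset V) :
    #{p ∈ F ×ˢ F | ¬ Disjoint (P p.1) (P p.2)} ≤ ∑ z, congestion F P z ^ 2 := by
  have h : {p ∈ F ×ˢ F | ¬ Disjoint (P p.1) (P p.2)} ⊆
      univ.biUnion fun z => {j ∈ F | z ∈ P j} ×ˢ {j ∈ F | z ∈ P j} := by
    intro p hp
    simp only [Finset.mem_filter, Finset.mem_product, Finset.not_disjoint_iff] at hp
    obtain ⟨⟨h1, h2⟩, z, h3, h4⟩ := hp
    simp only [Finset.mem_biUnion, Finset.mem_univ, true_and, Finset.mem_product,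
      Finset.mem_filter]
    exact ⟨z, ⟨h1, h3⟩, h2, h4⟩
  refine (Finset.card_le_card h).trans (Finset.card_biUnion_le.trans ?_)
  refine Finset.sum_le_sum fun z _ => ?_
  rw [Finset.card_product, sq]
  rfl

lemma card_overlapping_pairs_mul_le {I X α β : Type*} [Fintype I] [Fintype X] [Fintype α]
    [Fintype β] (F : Finset (I × X)) (P : I × X → Finset V) {i i' : α} (hi : i ≠ i') {e e' : β}
    (he : e ≠ e') :
    #{p : (α → I) × (β → X) | (p.1 i, p.2 e) ∈ F ∧ (p.1 i', p.2 e') ∈ F ∧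
        ¬ Disjoint (P (p.1 i, p.2 e)) (P (p.1 i', p.2 e'))} *
        (Fintype.card I * Fintype.card X) ^ 2 ≤
      Fintype.card I ^ Fintype.card α * Fintype.card X ^ Fintype.card β *
        ∑ z, congestion F P z ^ 2 := by
  refine le_trans ?_ (Nat.mul_le_mul_left _ (card_overlapping_le F P))
  set bad := {p : (α → I) × (β → X) | (p.1 i, p.2 e) ∈ F ∧ (p.1 i', p.2 e') ∈ F ∧
        ¬ Disjoint (P (p.1 i, p.2 e)) (P (p.1 i', p.2 e'))}.toFinset
  have hdom : #(bad ×ˢ (univ : Finset ((I × I) × (X × X)))) =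
      #bad * (Fintype.card I * Fintype.card X) ^ 2 := by
    rw [Finset.card_product, Finset.card_univ]
    simp only [Fintype.card_prod]
    ring
  have hcod : #((univ : Finset ((α → I) × (β → X))) ×ˢ
      {p ∈ F ×ˢ F | ¬ Disjoint (P p.1) (P p.2)}) =
      Fintype.card I ^ Fintype.card α * Fintype.card X ^ Fintype.card β *
        #{p ∈ F ×ˢ F | ¬ Disjoint (P p.1) (P p.2)} := by
    rw [Finset.card_product, Finset.card_univ]
    simp
  have hbad : #{p : (α → I) × (β → X) | (p.1 i, p.2 e) ∈ F ∧ (p.1 i', p.2 e') ∈ F ∧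
        ¬ Disjoint (P (p.1 i, p.2 e)) (P (p.1 i', p.2 e'))} = #bad := by
    congr 1
    ext p
    simp [bad]
  rw [hbad, ← hdom, ← hcod]
  refine Finset.card_le_card_of_injOn
    (fun q => ((Function.update (Function.update q.1.1 i q.2.1.1) i' q.2.1.2,
      Function.update (Function.update q.1.2 e q.2.2.1) e' q.2.2.2),
      ((q.1.1 i, q.1.2 e), (q.1.1 i', q.1.2 e')))) ?_ ?_
  · intro q hq
    simp only [Finset.coe_product, Set.mem_prod, Finset.mem_coe, bad, Set.mem_toFinset] at hq
    simp only [Finset.coe_product, Set.mem_prod, Finset.mem_coe, Finset.mem_univ, true_and,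
      Finset.mem_filter, Finset.mem_product]
    exact ⟨⟨hq.1.1, hq.1.2.1⟩, hq.1.2.2⟩
  · rintro ⟨⟨a, b⟩, ⟨u, v⟩, x, y⟩ - ⟨⟨a', b'⟩, ⟨u', v'⟩, x', y'⟩ - h
    simp only [Prod.mk.injEq] at h
    obtain ⟨⟨h1, h2⟩, ⟨h3, h4⟩, h5, h6⟩ := h
    have hu := congrFun h1 i
    have hv := congrFun h1 i'
    have hx := congrFun h2 e
    have hy := congrFun h2 e'
    simp [hi, he] at hu hv hx hy
    have ha : a = a' := by
      funext l
      have := congrFun h1 l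
      by_cases hl : l = i
      · rw [hl, h3]
      by_cases hl' : l = i'
      · rw [hl', h5]
      simpa [hl, hl'] using this
    have hb : b = b' := by
      funext l
      have := congrFun h2 l
      by_cases hl : l = e
      · rw [hl, h4]
      by_cases hl' : l = e'
      · rw [hl', h6]
      simpa [hl, hl'] using this
    simp [ha, hb, hu, hv, hx, hy]

/-- Given a dense family of sets indexed by pairs which overlap little on average, one can select
rows and columns such that any two of the selected sets in different rows and columns are
disjoint. -/
lemma exists_disjoint_selection {I X α β : Type*} [Fintype I] [Fintype X] [Fintype α]
    [Fintype β] (F : Finset (I × X)) (P : I × X → Finset V)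
    (h : (Fintype.card I * Fintype.card X) ^ (Fintype.card α * Fintype.card β) *
        ((Fintype.card α * Fintype.card β) ^ 2 * ∑ z, congestion F P z ^ 2) <
      #F ^ (Fintype.card α * Fintype.card β) * (Fintype.card I * Fintype.card X) ^ 2) :
    ∃ (a : α → I) (b : β → X), (∀ i e, (a i, b e) ∈ F) ∧
      ∀ i i' e e', i ≠ i' → e ≠ e' → Disjoint (P (a i, b e)) (P (a i', b e')) := by
  by_contra! hcon
  have hIX : 0 < Fintype.card I * Fintype.card X := by
    rcases Nat.eq_zero_or_pos (Fintype.card I * Fintype.card X) with h0 | h0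
    · simp [h0] at h
    · exact h0
  have hI : 0 < Fintype.card I := Nat.pos_of_mul_pos_right hIX
  have hX : 0 < Fintype.card X := Nat.pos_of_mul_pos_left hIX
  set A := Fintype.card α
  set B := Fintype.card β
  set conf := ∑ z, congestion F P z ^ 2
  set N := Fintype.card I * Fintype.card X with hN
  set S : Finset ((α × α) × (β × β)) := univ.filter fun s => s.1.1 ≠ s.1.2 ∧ s.2.1 ≠ s.2.2
  set bad : (α × α) × (β × β) → Finset ((α → I) × (β → X)) := fun s =>
    {p : (α → I) × (β → X) | (p.1 s.1.1, p.2 s.2.1) ∈ F ∧ (p.1 s.1.2, p.2 s.2.2) ∈ F ∧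
        ¬ Disjoint (P (p.1 s.1.1, p.2 s.2.1)) (P (p.1 s.1.2, p.2 s.2.2))} with hbad
  have hsub : ({p : (α → I) × (β → X) | ∀ i e, (p.1 i, p.2 e) ∈ F} : Finset _) ⊆
      S.biUnion bad := by
    intro p hp
    simp only [Finset.mem_filter, Finset.mem_univ, true_and] at hp
    obtain ⟨i, i', e, e', hi, he, hd⟩ := hcon p.1 p.2 hp
    simp only [Finset.mem_biUnion]
    refine ⟨((i, i'), (e, e')), by simp [S, hi, he], ?_⟩
    simp only [hbad, Finset.mem_filter, Finset.mem_univ, true_and]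
    exact ⟨hp _ _, hp _ _, hd⟩
  have hS : #S ≤ (A * B) ^ 2 := by
    refine (Finset.card_le_univ S).trans (le_of_eq ?_)
    simp only [Fintype.card_prod]
    ring
  have hsum : #{p : (α → I) × (β → X) | ∀ i e, (p.1 i, p.2 e) ∈ F} * N ^ 2 ≤
      (A * B) ^ 2 * (Fintype.card I ^ A * Fintype.card X ^ B * conf) := by
    calc _ ≤ (∑ s ∈ S, #(bad s)) * N ^ 2 :=
          Nat.mul_le_mul_right _ ((Finset.card_le_card hsub).trans Finset.card_biUnion_le)
      _ = ∑ s ∈ S, #(bad s) * N ^ 2 := Finset.sum_mul ..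
      _ ≤ ∑ s ∈ S, (Fintype.card I ^ A * Fintype.card X ^ B * conf) := by
          refine Finset.sum_le_sum fun s hs => ?_
          simp only [S, Finset.mem_filter, Finset.mem_univ, true_and] at hs
          exact card_overlapping_pairs_mul_le F P hs.1 hs.2
      _ ≤ _ := by
          rw [Finset.sum_const, smul_eq_mul]
          exact Nat.mul_le_mul_right _ hS
  have hgood := card_complete_bipartite_hom (α := α) (β := β) F
  have hpos : 0 < Fintype.card I ^ A * Fintype.card X ^ B := by positivity
  refine absurd h (not_lt.2 (Nat.le_of_mul_le_mul_right ?_ hpos))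
  calc #F ^ (A * B) * N ^ 2 * (Fintype.card I ^ A * Fintype.card X ^ B)
      = #F ^ (A * B) * (Fintype.card I ^ A * Fintype.card X ^ B) * N ^ 2 := by ring
    _ ≤ N ^ (A * B) * #{p : (α → I) × (β → X) | ∀ i e, (p.1 i, p.2 e) ∈ F} * N ^ 2 :=
        Nat.mul_le_mul_right _ hgood
    _ = N ^ (A * B) * (#{p : (α → I) × (β → X) | ∀ i e, (p.1 i, p.2 e) ∈ F} * N ^ 2) := by ring
    _ ≤ N ^ (A * B) * ((A * B) ^ 2 * (Fintype.card I ^ A * Fintype.card X ^ B * conf)) :=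
        Nat.mul_le_mul_left _ hsum
    _ = _ := by ring

/-- Connected sets joining `t` centres to common endpoints, one endpoint for every pair of centres,
yield a small `K_t`-minor. -/
lemma hasKtMinorOfOrder_of_links {W : Type*} {G : SimpleGraph W} {t k : ℕ} {v : Fin t → W}
    {b : Fin t × Fin t → W} {Q : Fin t → Fin t × Fin t → Finset W}
    (hQ : ∀ i e, Links G k (v i) (b e) (Q i e))
    (hd : ∀ i i' e e', i ≠ i' → e ≠ e' → Disjoint (Q i e) (Q i' e')) :
    HasKtMinorOfOrder G t ((t : ℝ) ^ 2 * k) := by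
  have hpart : ∀ i i' : Fin t, ∃ B ⊆ Q i' (i, i'), ConnOn G B ∧ v i' ∈ B ∧ (i < i' →
      Disjoint B (Q i (i, i')) ∧ ∃ c ∈ B, ∃ d ∈ Q i (i, i'), G.Adj c d) := by
    intro i i'
    by_cases hlt : i < i'
    · have hv : v i' ∉ Q i (i, i') := fun h =>
        Finset.disjoint_left.1 (hd i i' (i, i') (i, i) hlt.ne (by simp [hlt.ne'])) h (hQ i' _).2.1
      obtain ⟨B, h1, h2, h3, h4, h5⟩ := (hQ i' (i, i')).1.exists_part_touching (hQ i' _).2.1 hv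
        ⟨b (i, i'), Finset.mem_inter.2 ⟨(hQ i _).2.2.1, (hQ i' _).2.2.1⟩⟩
      exact ⟨B, h1, h2, h3, fun _ => ⟨h4, h5⟩⟩
    · exact ⟨Q i' (i, i'), subset_rfl, (hQ _ _).1, (hQ _ _).2.1, fun h => absurd h hlt⟩
  choose B hBsub hBconn hBv hB using hpart
  set T : Fin t → Fin t → Finset W := fun i l => if i < l then Q i (i, l) else B l i with hT
  have hTsub : ∀ i l, T i l ⊆ Q i (min i l, max i l) := by
    intro i l
    by_cases h : i < l
    · simp [hT, h, h.le]
    · have h' := not_lt.1 h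
      simpa [hT, h, h'] using hBsub l i
  have hTconn : ∀ i l, ConnOn G (T i l) := by
    intro i l
    simp only [hT]
    split_ifs
    exacts [(hQ _ _).1, hBconn _ _]
  have hTv : ∀ i l, v i ∈ T i l := by
    intro i l
    simp only [hT]
    split_ifs
    exacts [(hQ _ _).2.1, hBv _ _]
  have hswap : ∀ i l, i < l → Disjoint (T i l) (T l i) := by
    intro i l hil
    simp only [hT, hil, if_true, hil.not_gt, if_false]
    exact (hB i l hil).1.symm
  have hTd : ∀ i i' l l', i ≠ i' → Disjoint (T i l) (T i' l') := by
    intro i i' l l' hi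
    by_cases he : (min i l, max i l) = (min i' l', max i' l')
    · have hl : l = i' ∧ l' = i := by
        simp only [Prod.mk.injEq] at he
        grind
      obtain ⟨rfl, rfl⟩ := hl
      rcases lt_or_gt_of_ne hi with h | h
      · exact hswap _ _ h
      · exact (hswap _ _ h).symm
    · exact (hd i i' _ _ hi he).mono (hTsub i l) (hTsub i' l')
  set P : Fin t → Finset W := fun i => univ.biUnion (T i) with hP
  have hmem : ∀ i l, T i l ⊆ P i := fun i l =>
    Finset.subset_biUnion_of_mem (T i) (Finset.mem_univ l)
  refine ⟨fun i => (P i : Set W), fun i => ⟨v i, hmem i i (hTv i i)⟩, fun i j hij => ?_,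
    fun i => ?_, fun i j hij => ?_, ?_⟩
  · simp only [Function.onFun, Finset.disjoint_coe, hP, Finset.disjoint_biUnion_left,
      Finset.disjoint_biUnion_right]
    exact fun l _ l' _ => hTd i j _ _ hij
  · exact connOn_biUnion ⟨i, Finset.mem_univ i⟩ (fun l _ => hTconn i l) (fun l _ => hTv i l)
  · obtain ⟨c, hc, d, hd', hcd⟩ := (hB i j hij).2
    refine ⟨d, hmem i j ?_, c, hmem j i ?_, hcd.symm⟩
    · simpa [hT, hij] using hd'
    · simpa [hT, hij.not_gt] using hc
  · have h1 : (⋃ i, (P i : Set W)) = ((univ.biUnion P : Finset W) : Set W) := by simp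
    rw [h1, Set.ncard_coe_finset]
    have hTcard : ∀ i l, #(T i l) ≤ k := fun i l =>
      (Finset.card_le_card (hTsub i l)).trans (hQ _ _).2.2.2
    have h2 : #(univ.biUnion P) ≤ t ^ 2 * k := by
      calc #(univ.biUnion P) ≤ ∑ i, #(P i) := Finset.card_biUnion_le
        _ ≤ ∑ i, ∑ l, #(T i l) := Finset.sum_le_sum fun i _ => Finset.card_biUnion_le
        _ ≤ ∑ _i : Fin t, ∑ _l : Fin t, k :=
            Finset.sum_le_sum fun i _ => Finset.sum_le_sum fun l _ => hTcard i l
        _ = t ^ 2 * k := by simp; ring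
    exact_mod_cast h2

/-- A graph in which small sets expand has a small `K_t`-minor. -/
lemma ExpandsUpTo.hasKtMinorOfOrder {G : SimpleGraph V} {t x R : ℕ} {ρ : ℝ}
    (hG : ExpandsUpTo G x ρ) (ht : 1 ≤ t) (hx : 4 ≤ x) (hm : (x ^ t ^ 3) ^ 20 ≤ Fintype.card V)
    (hRy : 2 * R + 2 ≤ x ^ t ^ 3) (hρ : 0 < ρ) (hρy : 2 ≤ ρ * (x : ℝ) ^ t ^ 3)
    (hR : (Fintype.card V : ℝ) ≤ (1 + ρ / 2) ^ R) :
    HasKtMinorOfOrder G t ((t : ℝ) ^ 2 * (2 * R + 2 : ℕ)) := by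
  set m := Fintype.card V with hmdef
  set a := t ^ 3 with ha
  set y := x ^ a with hy
  have hx2 : 2 ≤ x := by omega
  have ha0 : a ≠ 0 := by positivity
  obtain ⟨u, hu⟩ : ∃ u, y = x * u := dvd_pow_self x ha0
  have hxy : x ≤ y := Nat.le_self_pow ha0 x
  have hy4 : 4 ≤ y := hx.trans hxy
  have hy0 : 0 < y := by omega
  have hρy' : (2 : ℝ) ≤ ρ * (y : ℝ) := by rw [hy]; exact_mod_cast hρy
  have hm0 : 0 < m := lt_of_lt_of_le (by positivity) hm
  have hu0 : 0 < u := by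
    rcases Nat.eq_zero_or_pos u with h | h
    · rw [h] at hu; omega
    · exact h
  obtain ⟨c, C, hC, hCd⟩ := exists_disjoint_cores hG hx2 hρ hR (s := 2 * y ^ 12) (q := y ^ 6)
    (M := 2 * y ^ 5) (Nat.one_le_pow _ _ hy0) (by have := Nat.one_le_pow 12 y hy0; omega)
    (by
      refine le_trans ?_ hm
      calc 2 * y ^ 12 + 2 * y ^ 5 * y ^ 6 = 2 * y ^ 12 + 2 * y ^ 11 := by ring
        _ ≤ 2 * y ^ 12 + 2 * y ^ 12 := by gcongr; omega
        _ = 4 * y ^ 12 := by ring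
        _ ≤ y * y ^ 12 := by gcongr
        _ = y ^ 13 := by ring
        _ ≤ y ^ 20 := Nat.pow_le_pow_right hy0 (by norm_num))
    (by
      push_cast
      calc 2 * (y : ℝ) ^ 5 * (y : ℝ) ^ 6 = 2 * (y : ℝ) ^ 11 := by ring
        _ ≤ (ρ * y) * (y : ℝ) ^ 11 := by gcongr
        _ = ρ / 2 * (2 * (y : ℝ) ^ 12) := by ring)
    (by
      refine le_trans ?_ hm
      calc y ^ 6 * (2 * y ^ 12) * x = 2 * x * y ^ 18 := by ring
        _ ≤ y * y * y ^ 18 := by gcongr; omega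
        _ = y ^ 20 := by ring)
  set e := u * y ^ 4 * m with he
  have hxe : x * e = y ^ 5 * m := by
    rw [he]
    calc x * (u * y ^ 4 * m) = (x * u) * y ^ 4 * m := by ring
      _ = y ^ 5 * m := by rw [← hu]; ring
  obtain ⟨F, P, hFe, hFP, hconf⟩ := exists_low_congestion (J := Fin (2 * y ^ 5) × V)
    (fun j Q => Links G (2 * R + 2) (c j.1) j.2 Q) (k := 2 * R + 2) (h := 2 * y * m)
    (w := y ^ 5) (e := e) (fun j Q hQ => hQ.2.2.2) (by positivity)
    (by
      rw [Fintype.card_prod, Fintype.card_fin, ← hmdef]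
      calc 2 * y ^ 5 * m * (2 * R + 2) ≤ 2 * y ^ 5 * m * y := by gcongr
        _ = y ^ 5 * (2 * y * m) := by ring)
    (by
      intro W hW
      have h1 := card_linked_avoiding hG hx2 hρ hR (Nat.one_le_pow _ _ hy0) hC hCd (W := W)
        (by
          push_cast
          calc (#W : ℝ) ≤ ((y ^ 5 : ℕ) : ℝ) := by exact_mod_cast hW
            _ = 2 / 2 * (y : ℝ) ^ 5 := by push_cast; ring
            _ ≤ (ρ * y) / 2 * (y : ℝ) ^ 5 := by gcongr
            _ = ρ / 2 * (y : ℝ) ^ 6 := by ring)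
      refine Nat.le_of_mul_le_mul_left ?_ (show 0 < x by omega)
      rw [hxe]
      refine le_trans ?_ h1
      gcongr
      omega)
  have ha2 : a ^ 2 ≤ 4 ^ a := by
    have : a ≤ 2 ^ a := Nat.lt_two_pow_self.le
    calc a ^ 2 ≤ (2 ^ a) ^ 2 := by gcongr
      _ = 4 ^ a := by rw [← pow_mul, mul_comm, pow_mul]; norm_num
  have hy16 : 16 ^ a ≤ y ^ 2 := by
    calc 16 ^ a = (4 ^ a) ^ 2 := by rw [← pow_mul, mul_comm a 2, pow_mul]; norm_num
      _ ≤ (x ^ a) ^ 2 := by gcongr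
  have hnum : 5 * 2 ^ a * a ^ 2 < 4 * x * y ^ 2 := by
    calc 5 * 2 ^ a * a ^ 2 ≤ 5 * 2 ^ a * 4 ^ a := by gcongr
      _ = 5 * 8 ^ a := by rw [mul_assoc, ← mul_pow]; norm_num
      _ < 16 * 16 ^ a :=
          Nat.mul_lt_mul_of_lt_of_le (by norm_num) (Nat.pow_le_pow_left (by norm_num) a)
            (by positivity)
      _ ≤ 4 * x * y ^ 2 := by gcongr; omega
  have hconf' : ∑ z, congestion F P z ^ 2 ≤ 5 * e * y ^ 2 * m := by
    refine hconf.trans ?_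
    calc e * ((2 * R + 2) * (2 * (2 * y * m) + 1)) ≤ e * (y * (4 * (y * m) + y * m)) := by
          have h1 : 1 ≤ y * m := Nat.mul_pos hy0 hm0
          have h2 : 2 * (2 * y * m) + 1 ≤ 4 * (y * m) + y * m := by rw [mul_assoc 2 y m]; omega
          exact Nat.mul_le_mul_left _ (Nat.mul_le_mul hRy h2)
      _ = 5 * e * y ^ 2 * m := by ring
  have he0 : 0 < e := by positivity
  obtain ⟨i, b, hib, hdis⟩ := exists_disjoint_selection (α := Fin t) (β := Fin t × Fin t) F P
    (by
      simp only [Fintype.card_prod, Fintype.card_fin, ← hmdef, hFe]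
      have hta : t * (t * t) = a := by rw [ha]; ring
      have hN : 2 * y ^ 5 * m = 2 * x * e := by rw [mul_assoc, ← hxe]; ring
      rw [hta, hN]
      calc (2 * x * e) ^ a * (a ^ 2 * ∑ z, congestion F P z ^ 2)
          ≤ (2 * x * e) ^ a * (a ^ 2 * (5 * e * y ^ 2 * m)) := by gcongr
        _ = (5 * 2 ^ a * a ^ 2) * (e ^ a * e * y ^ 3 * m) := by rw [mul_pow, mul_pow, ← hy]; ring
        _ < (4 * x * y ^ 2) * (e ^ a * e * y ^ 3 * m) :=
            Nat.mul_lt_mul_of_pos_right hnum (by positivity)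
        _ = e ^ a * (4 * x * e * (y ^ 5 * m)) := by ring
        _ = e ^ a * (2 * x * e) ^ 2 := by rw [← hxe]; ring)
  exact hasKtMinorOfOrder_of_links (v := fun l => c (i l)) (b := b) (Q := fun l p => P (i l, b p))
    (fun l p => hFP _ (hib l p)) hdis

/-- The number of ordered pairs of adjacent vertices in `A`. -/
noncomputable def adjPairs {W : Type*} (G : SimpleGraph W) (A : Finset W) : ℕ :=
  #{p ∈ A ×ˢ A | G.Adj p.1 p.2}

lemma adjPairs_eq_sum {W : Type*} (G : SimpleGraph W) (A : Finset W) :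
    adjPairs G A = ∑ u ∈ A, #{v ∈ A | G.Adj u v} := by
  simp only [adjPairs, Finset.card_filter]
  rw [Finset.sum_product]

lemma density_eq (G : SimpleGraph V) :
    density G = adjPairs G univ / (2 * Fintype.card V) := by
  have h : adjPairs G univ = 2 * G.edgeSet.ncard := by
    rw [adjPairs_eq_sum, Set.ncard_eq_toFinset_card', ← SimpleGraph.edgeFinset,
      ← SimpleGraph.sum_degrees_eq_twice_card_edges]
    refine Finset.sum_congr rfl fun u _ => ?_
    rw [← SimpleGraph.card_neighborFinset_eq_degree]
    congr 1
    ext v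
    simp
  rw [density, h, Nat.card_eq_fintype_card]
  push_cast
  rw [mul_div_mul_left _ _ two_ne_zero]

lemma adjPairs_induce {W : Type*} (G : SimpleGraph W) (U : Finset W) :
    adjPairs (G.induce (U : Set W)) univ = adjPairs G U := by
  unfold adjPairs
  refine Finset.card_bij (fun p _ => (p.1.1, p.2.1)) ?_ ?_ ?_
  · intro p hp
    simp only [Finset.mem_filter, Finset.mem_product, SimpleGraph.comap_adj] at hp ⊢
    exact ⟨⟨p.1.2, p.2.2⟩, hp.2⟩
  · rintro ⟨a, b⟩ - ⟨a', b'⟩ - h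
    simp only [Prod.mk.injEq] at h
    exact Prod.ext (Subtype.ext h.1) (Subtype.ext h.2)
  · rintro ⟨a, b⟩ h
    simp only [Finset.mem_filter, Finset.mem_product] at h
    exact ⟨(⟨a, h.1.1⟩, ⟨b, h.1.2⟩), by simpa using h.2, rfl⟩

lemma density_induce {W : Type*} (G : SimpleGraph W) (U : Finset W) :
    density (G.induce (U : Set W)) = adjPairs G U / (2 * #U) := by
  rw [density_eq, adjPairs_induce]
  simp

lemma adjPairs_le_add {W : Type*} (G : SimpleGraph W) {U S A : Finset W}
    (hA : ∀ u ∈ S, ∀ v ∈ U, G.Adj u v → v ∈ A) (hSA : S ⊆ A) :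
    adjPairs G U ≤ adjPairs G A + adjPairs G (U \ S) := by
  unfold adjPairs
  refine (Finset.card_le_card ?_).trans (Finset.card_union_le _ _)
  rintro ⟨u, v⟩ h
  simp only [Finset.mem_filter, Finset.mem_product, Finset.mem_union, Finset.mem_sdiff] at h ⊢
  by_cases hu : u ∈ S
  · exact Or.inl ⟨⟨hSA hu, hA u hu v h.1.2 h.2⟩, h.2⟩
  by_cases hv : v ∈ S
  · exact Or.inl ⟨⟨hA v hv u h.1.1 h.2.symm, hSA hv⟩, h.2⟩
  · exact Or.inr ⟨⟨⟨h.1.1, hu⟩, h.1.2, hv⟩, h.2⟩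

/-- Every graph has a subgraph of comparable density in which closed neighbourhoods of small sets
are large. -/
lemma exists_dense_subset_growing {G : SimpleGraph V} {η : ℝ} (hη : 0 < η)
    (hV : 2 ≤ Fintype.card V) (hG : 0 < adjPairs G univ) :
    ∃ U : Finset V, U.Nonempty ∧
      (adjPairs G univ : ℝ) * #U ≤ (1 + η) * adjPairs G U * Fintype.card V ∧
      ∀ S ⊆ U, ∀ A ⊆ U, S.Nonempty → S ⊆ A → (∀ u ∈ S, ∀ v ∈ U, G.Adj u v → v ∈ A) →
        (1 + η / (1 + η) * (Real.log (#U / #A) / Real.log (Fintype.card V))) * #S ≤ #A := by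
  set n := Fintype.card V with hn
  have hL : 0 < Real.log n := Real.log_pos (by exact_mod_cast hV)
  set g : ℕ → ℝ := fun s => 1 + η * (1 - Real.log s / Real.log n) with hg
  have hgmono : ∀ r s : ℕ, 1 ≤ r → r ≤ s → g s ≤ g r := by
    intro r s hr hrs
    have : Real.log r ≤ Real.log s :=
      Real.log_le_log (by exact_mod_cast hr) (by exact_mod_cast hrs)
    simp only [hg]
    gcongr
  have hg1 : ∀ s : ℕ, 1 ≤ s → s ≤ n → 1 ≤ g s := by
    intro s h1 h2
    have h3 := hgmono s n h1 h2
    have h4 : g n = 1 := by simp only [hg]; rw [div_self hL.ne']; ring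
    linarith
  have hg2 : ∀ s : ℕ, 1 ≤ s → g s ≤ 1 + η := by
    intro s h1
    have : 0 ≤ Real.log s / Real.log n := div_nonneg (Real.log_natCast_nonneg s) hL.le
    simp only [hg]
    nlinarith
  set f : Finset V → ℝ := fun U => adjPairs G U / #U * g #U with hf
  have : Nonempty V := Fintype.card_pos_iff.1 (by omega)
  obtain ⟨U, hU, hmax⟩ := Finset.exists_max_image
    (univ.filter fun U : Finset V => U.Nonempty) f ⟨univ, by simp⟩
  simp only [Finset.mem_filter, Finset.mem_univ, true_and] at hU hmax
  have hcard : ∀ A : Finset V, A.Nonempty → (1 ≤ #A ∧ #A ≤ n ∧ (0 : ℝ) < #A) := fun A hA =>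
    ⟨hA.card_pos, Finset.card_le_univ A, by exact_mod_cast hA.card_pos⟩
  obtain ⟨hU1, hU2, hU3⟩ := hcard U hU
  set m := #U with hm
  have hn0 : (0 : ℝ) < n := by exact_mod_cast (by omega : 0 < n)
  have hdens : (adjPairs G univ : ℝ) * m ≤ (1 + η) * adjPairs G U * n := by
    have h1 := hmax univ Finset.univ_nonempty
    simp only [hf, Finset.card_univ, ← hn, ← hm] at h1
    have h2 : (adjPairs G univ : ℝ) / n ≤ adjPairs G univ / n * g n :=
      le_mul_of_one_le_right (by positivity) (hg1 n (by omega) le_rfl)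
    have h3 : (adjPairs G U : ℝ) / m * g m ≤ adjPairs G U / m * (1 + η) :=
      mul_le_mul_of_nonneg_left (hg2 m hU1) (by positivity)
    have h4 : (adjPairs G univ : ℝ) / n ≤ (1 + η) * adjPairs G U / m := by
      calc _ ≤ _ := h2.trans (h1.trans h3)
        _ = _ := by ring
    rwa [div_le_div_iff₀ hn0 hU3] at h4
  refine ⟨U, hU, hdens, fun S hSU A hAU hS hSA hA => ?_⟩
  set D : ℝ := adjPairs G U / m with hD
  have hD0 : 0 < D := by
    rcases Nat.eq_zero_or_pos (adjPairs G U) with h | h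
    · rw [h] at hdens
      have : (0 : ℝ) < adjPairs G univ * m := mul_pos (by exact_mod_cast hG) hU3
      simp only [Nat.cast_zero, mul_zero, zero_mul] at hdens
      linarith
    · exact div_pos (by exact_mod_cast h) hU3
  have hDm : (adjPairs G U : ℝ) = D * m := by rw [hD, div_mul_cancel₀ _ hU3.ne']
  have hgm : 0 < g m := lt_of_lt_of_le one_pos (hg1 m hU1 hU2)
  obtain ⟨hA1, hA2, hA3⟩ := hcard A (hS.mono hSA)
  have hrest : (adjPairs G (U \ S) : ℝ) ≤ D * #(U \ S) := by
    rcases (U \ S).eq_empty_or_nonempty with h | h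
    · simp [h, adjPairs]
    · obtain ⟨h1, -, h3⟩ := hcard _ h
      have h4 := hmax _ h
      have h5 : g m ≤ g #(U \ S) := hgmono _ _ h1 (Finset.card_le_card Finset.sdiff_subset)
      simp only [hf] at h4
      have h6 : (adjPairs G (U \ S) : ℝ) / #(U \ S) * g m ≤ D * g m :=
        (mul_le_mul_of_nonneg_left h5 (div_nonneg (Nat.cast_nonneg _) h3.le)).trans h4
      have h7 := le_of_mul_le_mul_right h6 hgm
      rwa [div_le_iff₀ h3] at h7
  have hsdiff : (#(U \ S) : ℝ) = m - #S := by
    rw [Finset.card_sdiff_of_subset hSU, Nat.cast_sub (Finset.card_le_card hSU)]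
  have hAdj : D * #S ≤ adjPairs G A := by
    have h1 : (adjPairs G U : ℝ) ≤ adjPairs G A + adjPairs G (U \ S) := by
      exact_mod_cast adjPairs_le_add G hA hSA
    rw [hsdiff] at hrest
    nlinarith
  have hmaxA : (#S : ℝ) * g #A ≤ #A * g m := by
    have h1 := hmax A (hS.mono hSA)
    simp only [hf] at h1
    have hgA : 0 ≤ g #A := (zero_le_one.trans (hg1 _ hA1 hA2))
    have h2 : D * #S / #A * g #A ≤ D * g m :=
      (mul_le_mul_of_nonneg_right (div_le_div_of_nonneg_right hAdj hA3.le) hgA).trans h1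
    have h3 : D * (#S * g #A) ≤ D * (#A * g m) := by
      calc D * (#S * g #A) = D * #S / #A * #A * g #A := by
            rw [div_mul_cancel₀ _ hA3.ne']; ring
        _ = D * #S / #A * g #A * #A := by ring
        _ ≤ D * g m * #A := mul_le_mul_of_nonneg_right h2 hA3.le
        _ = _ := by ring
    exact le_of_mul_le_mul_left h3 hD0
  have hgA : g #A = g m + η * (Real.log (m / #A) / Real.log n) := by
    simp only [hg]
    rw [Real.log_div hU3.ne' hA3.ne']
    ring
  have hlog : 0 ≤ Real.log (m / #A) / Real.log n := by
    refine div_nonneg (Real.log_nonneg ?_) hL.le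
    rw [one_le_div hA3]
    exact_mod_cast Finset.card_le_card hAU
  set Λ := Real.log (m / #A) / Real.log n
  have h1 : (1 + η / (1 + η) * Λ) * g m ≤ g #A := by
    rw [hgA, add_mul, one_mul]
    have : η / (1 + η) * Λ * g m ≤ η / (1 + η) * Λ * (1 + η) :=
      mul_le_mul_of_nonneg_left (hg2 m hU1) (by positivity)
    have h' : η / (1 + η) * Λ * (1 + η) = η * Λ := by
      rw [mul_right_comm, div_mul_cancel₀ _ (by positivity)]
    linarith
  refine le_of_mul_le_mul_right ?_ hgm
  calc (1 + η / (1 + η) * Λ) * #S * g m = #S * ((1 + η / (1 + η) * Λ) * g m) := by ring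
    _ ≤ #S * g #A := mul_le_mul_of_nonneg_left h1 (Nat.cast_nonneg _)
    _ ≤ _ := hmaxA

lemma exists_dense_expanding_subset {G : SimpleGraph V} {η : ℝ} (hη : 0 < η)
    (hV : 2 ≤ Fintype.card V) (hG : 0 < adjPairs G univ) :
    ∃ U : Finset V, U.Nonempty ∧ density G ≤ (1 + η) * density (G.induce (U : Set V)) ∧
      ∀ x : ℕ, 4 ≤ x → ExpandsUpTo (G.induce (U : Set V)) x
        (η / (1 + η) * (Real.log x / (2 * Real.log (Fintype.card V)))) := by
  obtain ⟨U, hU, hdens, hgrow⟩ := exists_dense_subset_growing hη hV hG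
  have hL : 0 < Real.log (Fintype.card V) := Real.log_pos (by exact_mod_cast hV)
  have hU0 : (0 : ℝ) < #U := by exact_mod_cast hU.card_pos
  refine ⟨U, hU, ?_, fun x hx S hS => ?_⟩
  · rw [density_eq, density_induce]
    have hn : (0 : ℝ) < Fintype.card V := by exact_mod_cast (by omega : 0 < Fintype.card V)
    rw [← mul_div_assoc, div_le_div_iff₀ (by linarith) (by linarith)]
    linarith
  rcases S.eq_empty_or_nonempty with rfl | hSne
  · simp
  set H := G.induce (U : Set V) with hH
  set N := extNbhd H S with hN
  have hdisj : Disjoint S N := Finset.disjoint_left.2 fun v hv hv' => (mem_extNbhd.1 hv').1 hv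
  set S' : Finset V := S.map (Function.Embedding.subtype _) with hS'
  set A' : Finset V := (S ∪ N).map (Function.Embedding.subtype _) with hA'
  have hsub : ∀ T : Finset (U : Set V), T.map (Function.Embedding.subtype _) ⊆ U := by
    intro T v hv
    obtain ⟨w, -, rfl⟩ := Finset.mem_map.1 hv
    exact w.2
  have hA'card : #A' = #S + #N := by
    rw [hA', Finset.card_map, Finset.card_union_of_disjoint hdisj]
  have hS'card : #S' = #S := Finset.card_map _
  have hcardU : Fintype.card (U : Set V) = #U := by simp
  have key := hgrow S' (hsub S) A' (hsub _) (hSne.map) (Finset.map_subset_map.2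
    Finset.subset_union_left) (by
      intro u hu v hv huv
      obtain ⟨w, hw, rfl⟩ := Finset.mem_map.1 hu
      refine Finset.mem_map.2 ⟨⟨v, hv⟩, Finset.mem_union.2 ?_, rfl⟩
      by_cases h : (⟨v, hv⟩ : (U : Set V)) ∈ S
      · exact Or.inl h
      · exact Or.inr (mem_extNbhd.2 ⟨h, w, hw, huv⟩))
  rw [hS'card, hA'card] at key
  have hS0 : 1 ≤ #S := hSne.card_pos
  have hS0' : (0 : ℝ) < #S := by exact_mod_cast hS0
  have hη1 : η / (1 + η) ≤ 1 := (div_le_one (by linarith)).2 (by linarith)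
  have hη0 : 0 < η / (1 + η) := div_pos hη (by linarith)
  rw [hcardU] at hS
  have hx4 : (4 : ℝ) ≤ x := by exact_mod_cast hx
  have hlogx : 0 ≤ Real.log x := Real.log_natCast_nonneg x
  rcases le_or_gt (#S) (#N) with hle | hlt
  · have hxn : x ≤ Fintype.card V :=
      (Nat.le_mul_of_pos_left x hS0).trans (hS.trans (Finset.card_le_univ U))
    have h1 : Real.log x ≤ Real.log (Fintype.card V) :=
      Real.log_le_log (by linarith) (by exact_mod_cast hxn)
    have h2 : Real.log x / (2 * Real.log (Fintype.card V)) ≤ 1 := by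
      rw [div_le_one (by linarith)]
      linarith
    have h3 : η / (1 + η) * (Real.log x / (2 * Real.log (Fintype.card V))) ≤ 1 :=
      mul_le_one₀ hη1 (div_nonneg hlogx (by linarith)) h2
    calc _ ≤ 1 * (#S : ℝ) := mul_le_mul_of_nonneg_right h3 hS0'.le
      _ = #S := one_mul _
      _ ≤ #N := by exact_mod_cast hle
  · have h1 : ((#S + #N : ℕ) : ℝ) ≤ 2 * #S := by exact_mod_cast (by omega : #S + #N ≤ 2 * #S)
    have h0 : (0 : ℝ) < ((#S + #N : ℕ) : ℝ) := by exact_mod_cast (by omega : 0 < #S + #N)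
    have hSx : (#S : ℝ) * x ≤ #U := by exact_mod_cast hS
    have h2 : (x : ℝ) / 2 ≤ #U / ((#S + #N : ℕ) : ℝ) := by
      rw [div_le_div_iff₀ two_pos h0]
      nlinarith
    have h3 : Real.log x / 2 ≤ Real.log (#U / ((#S + #N : ℕ) : ℝ)) := by
      have h4 : Real.log x ≤ Real.log ((x / 2 : ℝ) ^ 2) :=
        Real.log_le_log (by linarith) (by nlinarith)
      rw [Real.log_pow] at h4
      have h5 := Real.log_le_log (by linarith) h2
      push_cast at h4
      linarith
    have h4 : Real.log x / (2 * Real.log (Fintype.card V)) ≤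
        Real.log (#U / ((#S + #N : ℕ) : ℝ)) / Real.log (Fintype.card V) := by
      rw [← div_div]
      exact div_le_div_of_nonneg_right h3 hL.le
    have h5 := mul_le_mul_of_nonneg_right (mul_le_mul_of_nonneg_left h4 hη0.le) hS0'.le
    have h6 : ((#S + #N : ℕ) : ℝ) = #S + #N := by push_cast; ring
    rw [h6] at key h5
    linarith

lemma HasKtMinorOfOrder.mono {W : Type*} {G : SimpleGraph W} {t : ℕ} {k l : ℝ}
    (h : HasKtMinorOfOrder G t k) (hkl : k ≤ l) : HasKtMinorOfOrder G t l := by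
  obtain ⟨P, h1, h2, h3, h4, h5⟩ := h
  exact ⟨P, h1, h2, h3, h4, h5.trans hkl⟩

lemma HasKtMinorOfOrder.of_embedding {W W' : Type*} {H : SimpleGraph W}
    {G : SimpleGraph W'} {t : ℕ} {k : ℝ} (h : HasKtMinorOfOrder H t k) (f : H ↪g G) :
    HasKtMinorOfOrder G t k := by
  obtain ⟨P, h1, h2, h3, h4, h5⟩ := h
  refine ⟨fun i => f '' P i, fun i => (h1 i).image f, fun i j hij => ?_, fun i => ?_,
    fun i j hij => ?_, ?_⟩
  · exact Set.disjoint_image_of_injective f.injective (h2 hij)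
  · let φ : H.induce (P i) →g G.induce (f '' P i) :=
      { toFun := fun v => ⟨f v, Set.mem_image_of_mem f v.2⟩
        map_rel' := fun {a b} hab => f.map_adj_iff.2 hab }
    refine (h3 i).map φ ?_
    rintro ⟨_, v, hv, rfl⟩
    exact ⟨⟨v, hv⟩, rfl⟩
  · obtain ⟨u, hu, v, hv, huv⟩ := h4 i j hij
    exact ⟨f u, Set.mem_image_of_mem f hu, f v, Set.mem_image_of_mem f hv, f.map_adj_iff.2 huv⟩
  · rwa [← Set.image_iUnion, Set.ncard_image_of_injective _ f.injective]

lemma HasKtMinor.hasKtMinorOfOrder {W : Type*} [Finite W] {G : SimpleGraph W} {t : ℕ}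
    (h : HasKtMinor G t) : HasKtMinorOfOrder G t (Nat.card W) := by
  obtain ⟨P, h1, h2, h3, h4⟩ := h
  exact ⟨P, h1, h2, h3, h4, by exact_mod_cast Set.ncard_le_card _⟩

lemma density_congr {W W' : Type*} {H : SimpleGraph W} {G : SimpleGraph W'} (f : H ≃g G) :
    density H = density G := by
  unfold density
  rw [Nat.card_congr f.toEquiv, ← Nat.card_coe_set_eq, ← Nat.card_coe_set_eq,
    Nat.card_congr f.mapEdgeSet]

lemma exists_pow_le_lt_succ_pow (m : ℕ) {Z : ℕ} (hZ : Z ≠ 0) :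
    ∃ x : ℕ, x ^ Z ≤ m ∧ m < (x + 1) ^ Z := by
  have hex : ∃ x : ℕ, m < (x + 1) ^ Z :=
    ⟨m, (Nat.lt_succ_self m).trans_le (Nat.le_self_pow hZ _)⟩
  refine ⟨Nat.find hex, ?_, Nat.find_spec hex⟩
  rcases h : Nat.find hex with _ | x
  · simp [hZ]
  · exact not_lt.1 (Nat.find_min hex (m := x) (by omega))

/-- A weakly expanding graph either has a small `K_t`-minor or is itself small. -/
lemma hasKtMinorOfOrder_or_card_le {G : SimpleGraph V} {n t : ℕ} {η : ℝ} (hη : 0 < η)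
    (hη1 : η ≤ 1) (ht : 1 ≤ t) (hn : 2 ≤ n) (hV : 1 ≤ Fintype.card V) (hVn : Fintype.card V ≤ n)
    (hG : ∀ x : ℕ, 4 ≤ x → ExpandsUpTo G x (η * (Real.log x / (2 * Real.log n)))) :
    HasKtMinorOfOrder G t ((t : ℝ) ^ 2 * ((640 * t ^ 3 / η + 8) * Real.log n)) ∨
      (Fintype.card V : ℝ) ≤ (2 * ((640 * t ^ 3 / η + 8) * Real.log n)) ^ (20 * t ^ 3) := by
  set L := Real.log n with hLdef
  set Z := 20 * t ^ 3 with hZdef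
  set K := 640 * (t : ℝ) ^ 3 / η + 8 with hK
  have ht' : (1 : ℝ) ≤ (t : ℝ) ^ 3 := by exact_mod_cast Nat.one_le_pow 3 t ht
  have ht3 : t ^ 3 ≠ 0 := by positivity
  have hL : 1 / 2 < L := by
    have h1 : Real.log 2 ≤ Real.log n := Real.log_le_log two_pos (by exact_mod_cast hn)
    have h2 := Real.log_two_gt_d9
    linarith
  have hKη : 640 * (t : ℝ) ^ 3 / η ≤ K := by linarith
  have hKη0 : 0 < 640 * (t : ℝ) ^ 3 / η := by positivity
  have hKL : 4 < K * L := by nlinarith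
  set m := Fintype.card V with hmdef
  obtain ⟨x, hxm, hmx⟩ := exists_pow_le_lt_succ_pow m (Z := Z) (by positivity)
  rcases lt_or_ge (x : ℝ) (K * L) with hx | hx
  · right
    calc (m : ℝ) ≤ ((x : ℝ) + 1) ^ Z := by exact_mod_cast hmx.le
      _ ≤ _ := by gcongr; linarith
  left
  have hx4r : (4 : ℝ) < x := hKL.trans_le hx
  have hx4 : 4 ≤ x := by exact_mod_cast hx4r.le
  have hlogx : 1 ≤ Real.log x := by
    have h1 : Real.log 4 ≤ Real.log x := Real.log_le_log (by norm_num) hx4r.le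
    have h2 : Real.log 4 = 2 * Real.log 2 := by
      rw [show (4 : ℝ) = 2 ^ 2 by norm_num, Real.log_pow]; norm_num
    have h3 := Real.log_two_gt_d9
    linarith
  have hxlepow : x ≤ x ^ t ^ 3 := Nat.le_self_pow ht3 x
  have hxn : Real.log x ≤ L := by
    refine Real.log_le_log (by linarith) ?_
    have : x ≤ x ^ Z := Nat.le_self_pow (by positivity) x
    exact_mod_cast this.trans (hxm.trans hVn)
  set ρ := η * (Real.log x / (2 * L)) with hρdef
  have hρ : 0 < ρ := by positivity
  have hρ1 : ρ ≤ 1 := by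
    refine mul_le_one₀ hη1 (by positivity) ?_
    rw [div_le_one (by linarith)]
    linarith
  set R := ⌈320 * (t : ℝ) ^ 3 / η * L⌉₊ with hR
  have hR1 : 320 * (t : ℝ) ^ 3 / η * L ≤ R := Nat.le_ceil _
  have hR2 : (R : ℝ) < 320 * (t : ℝ) ^ 3 / η * L + 1 := Nat.ceil_lt_add_one (by positivity)
  have hRK : ((2 * R + 2 : ℕ) : ℝ) ≤ K * L := by
    have : K * L = 2 * (320 * (t : ℝ) ^ 3 / η * L) + 8 * L := by rw [hK]; ring
    push_cast
    linarith
  have hmR : (m : ℝ) ≤ (1 + ρ / 2) ^ R := by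
    have h1 : ρ / 4 ≤ Real.log (1 + ρ / 2) := by
      have h2 := Real.one_sub_inv_le_log_of_pos (show 0 < 1 + ρ / 2 by linarith)
      have h3 : ρ / 4 ≤ 1 - (1 + ρ / 2)⁻¹ := by
        have h4 : 1 - (1 + ρ / 2)⁻¹ = (ρ / 2) / (1 + ρ / 2) := by
          field_simp
          ring
        rw [h4, le_div_iff₀ (by linarith)]
        nlinarith
      linarith
    have h2 : Real.log m ≤ Z * (2 * Real.log x) := by
      have h3 : (m : ℝ) ≤ ((x : ℝ) ^ 2) ^ Z := by
        calc (m : ℝ) ≤ ((x : ℝ) + 1) ^ Z := by exact_mod_cast hmx.le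
          _ ≤ _ := by gcongr; nlinarith
      have h4 := Real.log_le_log (by exact_mod_cast hV) h3
      rw [Real.log_pow, Real.log_pow] at h4
      exact_mod_cast h4
    have h3 : (Z : ℝ) * (2 * Real.log x) ≤ R * (ρ / 4) := by
      calc (Z : ℝ) * (2 * Real.log x) = 320 * (t : ℝ) ^ 3 / η * L * (ρ / 4) := by
            rw [hρdef, hZdef]
            push_cast
            field_simp
            ring
        _ ≤ _ := by gcongr
    have h4 : Real.log m ≤ Real.log ((1 + ρ / 2) ^ R) := by
      rw [Real.log_pow]
      have : (R : ℝ) * (ρ / 4) ≤ R * Real.log (1 + ρ / 2) := by gcongr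
      linarith
    exact (Real.log_le_log_iff (by exact_mod_cast hV) (by positivity)).1 h4
  have hρx : 2 ≤ ρ * (x : ℝ) ^ t ^ 3 := by
    have h1 : (x : ℝ) ≤ (x : ℝ) ^ t ^ 3 := by exact_mod_cast hxlepow
    have h2 : 640 / η * L ≤ x := by
      refine le_trans ?_ hx
      gcongr
      refine le_trans ?_ hKη
      gcongr
      linarith
    calc (2 : ℝ) ≤ 320 := by norm_num
      _ = η * (1 / (2 * L)) * (640 / η * L) := by field_simp; norm_num
      _ ≤ ρ * (x : ℝ) ^ t ^ 3 := by
          rw [hρdef]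
          exact mul_le_mul (by gcongr) (h2.trans h1) (by positivity) (by positivity)
  refine ((hG x hx4).hasKtMinorOfOrder ht hx4 ?_ ?_ hρ hρx hmR).mono ?_
  · rw [← pow_mul, mul_comm (t ^ 3)]
    exact hxm
  · have : ((2 * R + 2 : ℕ) : ℝ) ≤ (x ^ t ^ 3 : ℕ) :=
      hRK.trans (hx.trans (by exact_mod_cast hxlepow))
    exact_mod_cast this
  · gcongr

/-- A dense graph has a small `K_t`-minor or a polylogarithmically small subgraph which is almost
as dense. -/
lemma exists_minor_or_small_dense_subset.{u} {t : ℕ} (ht : 1 ≤ t) {c ε : ℝ} (hc : 0 ≤ c)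
    (hε : 0 < ε) :
    ∃ K : ℝ, 1 ≤ K ∧ ∀ (W : Type u) [Fintype W] (G : SimpleGraph W), c + ε ≤ density G →
      HasKtMinorOfOrder G t (K * Real.log (Fintype.card W)) ∨
        ∃ U : Finset W, (#U : ℝ) ≤ (K * Real.log (Fintype.card W)) ^ (20 * t ^ 3) ∧
          c + ε / 2 ≤ density (G.induce (U : Set W)) := by
  set η : ℝ := (ε / 2) / (c + ε / 2) with hη
  have hη0 : 0 < η := by positivity
  set K₀ := 640 * (t : ℝ) ^ 3 / (η / (1 + η)) + 8 with hK₀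
  have hK₀8 : 8 ≤ K₀ := by
    have : 0 < 640 * (t : ℝ) ^ 3 / (η / (1 + η)) := by positivity
    linarith
  have ht1 : (1 : ℝ) ≤ (t : ℝ) ^ 2 := by exact_mod_cast Nat.one_le_pow 2 t ht
  refine ⟨2 * (t : ℝ) ^ 2 * K₀, by nlinarith, fun W _ G hG => ?_⟩
  have hpos : 0 < adjPairs G univ := by
    rcases Nat.eq_zero_or_pos (adjPairs G univ) with h | h
    · rw [density_eq, h] at hG
      simp only [Nat.cast_zero, zero_div] at hG
      linarith
    · exact h
  have hW : 2 ≤ Fintype.card W := by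
    obtain ⟨p, hp⟩ := Finset.card_pos.1 hpos
    exact Fintype.one_lt_card_iff.2 ⟨p.1, p.2, (Finset.mem_filter.1 hp).2.ne⟩
  obtain ⟨U, hU, hdens, hexp⟩ := exists_dense_expanding_subset hη0 hW hpos
  have hL : 0 ≤ Real.log (Fintype.card W) := Real.log_natCast_nonneg _
  have hcardU : Fintype.card (U : Set W) = #U := by simp
  rcases hasKtMinorOfOrder_or_card_le (t := t) (div_pos hη0 (by linarith))
    ((div_le_one (by linarith)).2 (by linarith)) ht hW (by rw [hcardU]; exact hU.card_pos)
    (by rw [hcardU]; exact Finset.card_le_univ U) hexp with h | h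
  · left
    refine (h.of_embedding (SimpleGraph.Embedding.induce _)).mono ?_
    rw [← hK₀]
    have : 0 ≤ (t : ℝ) ^ 2 * (K₀ * Real.log (Fintype.card W)) := by positivity
    linarith
  · right
    refine ⟨U, ?_, ?_⟩
    · rw [hcardU, ← hK₀] at h
      refine h.trans (pow_le_pow_left₀ (by positivity) ?_ _)
      have : 0 ≤ K₀ * Real.log (Fintype.card W) := by positivity
      nlinarith
    · have h1 : (1 + η) * (c + ε / 2) = c + ε := by
        rw [hη]
        field_simp
        ring
      have h2 := hG.trans hdens
      rw [← h1] at h2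
      exact le_of_mul_le_mul_left h2 (by linarith)

lemma adjPairs_insert {W : Type*} (G : SimpleGraph W) {A : Finset W} {u : W} (hu : u ∉ A) :
    adjPairs G (insert u A) = adjPairs G A + 2 * #{v ∈ A | G.Adj u v} := by
  have h1 : ∀ v ∈ A, #{w ∈ insert u A | G.Adj v w} =
      #{w ∈ A | G.Adj v w} + if G.Adj u v then 1 else 0 := by
    intro v _
    simp only [Finset.card_filter]
    rw [Finset.sum_insert hu, add_comm]
    simp only [G.adj_comm v u]
  have h2 : #{w ∈ insert u A | G.Adj u w} = #{w ∈ A | G.Adj u w} := by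
    simp only [Finset.card_filter]
    rw [Finset.sum_insert hu]
    simp
  rw [adjPairs_eq_sum, adjPairs_eq_sum, Finset.sum_insert hu, h2, Finset.sum_congr rfl h1,
    Finset.sum_add_distrib, ← Finset.card_filter]
  ring

/-- Mader's theorem: a graph of sufficiently large density has a `K_t`-minor. -/
lemma exists_branch_sets (G : SimpleGraph V) (t : ℕ) (U : Finset V) (hU : U.Nonempty)
    (hdens : 2 * 2 ^ t * #U ≤ adjPairs G U) :
    ∃ P : Fin t → Finset V, (∀ i, ConnOn G (P i) ∧ P i ⊆ U) ∧
      Pairwise (Function.onFun Disjoint P) ∧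
      ∀ i j, i < j → ∃ u ∈ P i, ∃ v ∈ P j, G.Adj u v := by
  induction t generalizing U with
  | zero => exact ⟨fun i => i.elim0, fun i => i.elim0, fun i => i.elim0, fun i => i.elim0⟩
  | succ t ih =>
    obtain ⟨U', hU', hmin⟩ := Finset.exists_min_image
      (U.powerset.filter fun A => A.Nonempty ∧ 2 * 2 ^ (t + 1) * #A ≤ adjPairs G A)
      (fun A => #A) ⟨U, by simp [hU, hdens]⟩
    simp only [Finset.mem_filter, Finset.mem_powerset] at hU' hmin
    obtain ⟨hU'U, ⟨r, hr⟩, hdens'⟩ := hU'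
    set D := 2 * 2 ^ (t + 1) with hD
    have hD4 : D = 4 * 2 ^ t := by rw [hD]; ring
    set N : Finset V → Finset V := fun X => {v ∈ U' \ X | ∃ u ∈ X, G.Adj u v} with hN
    have hmemN : ∀ X v, v ∈ N X ↔ (v ∈ U' ∧ v ∉ X) ∧ ∃ u ∈ X, G.Adj u v := by
      intro X v
      simp [hN]
    obtain ⟨X, hX, hmax⟩ := Finset.exists_max_image
      (U'.powerset.filter fun X => ConnOn G X ∧
        D * (#(U' \ X) + 1) ≤ adjPairs G (U' \ X) + 2 * #(N X)) (fun X => #X) ⟨{r}, by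
          have h1 : r ∉ U' \ {r} := by simp
          have h2 : insert r (U' \ {r}) = U' := by
            ext v
            by_cases hv : v = r <;> simp [hv, hr]
          have h3 := Finset.card_insert_of_notMem h1
          have h4 := adjPairs_insert G h1
          have h5 : N {r} = {v ∈ U' \ {r} | G.Adj r v} := by
            ext v
            simp [hN]
          rw [h2] at h3 h4
          simp only [Finset.mem_filter, Finset.mem_powerset, Finset.singleton_subset_iff]
          refine ⟨hr, connOn_singleton G r, ?_⟩
          rw [h5, ← h4, ← h3]
          exact hdens'⟩
    simp only [Finset.mem_filter, Finset.mem_powerset] at hX hmax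
    obtain ⟨hXU, hXc, hXD⟩ := hX
    have hD0 : 0 < D := by positivity
    have hNne : (N X).Nonempty := by
      by_contra hempty
      rw [Finset.not_nonempty_iff_eq_empty] at hempty
      rw [hempty, Finset.card_empty, mul_zero, add_zero, mul_add] at hXD
      have hne : (U' \ X).Nonempty := by
        by_contra h
        rw [Finset.not_nonempty_iff_eq_empty] at h
        simp only [h, adjPairs, Finset.product_empty, Finset.filter_empty,
          Finset.card_empty] at hXD
        omega
      have h1 := hmin (U' \ X) ⟨Finset.sdiff_subset.trans hU'U, hne, by omega⟩
      obtain ⟨w, hw⟩ := hXc.nonempty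
      have h2 : #(U' \ X) < #U' := Finset.card_lt_card
        (Finset.ssubset_iff_of_subset Finset.sdiff_subset |>.2 ⟨w, hXU hw, by simp [hw]⟩)
      omega
    have hdeg : ∀ u ∈ N X, 2 * 2 ^ t ≤ #{v ∈ N X | G.Adj u v} := by
      intro u hu
      obtain ⟨⟨huU, huX⟩, w, hw, hwu⟩ := (hmemN X u).1 hu
      have hset : U' \ X = insert u (U' \ insert u X) := by
        ext v
        by_cases hv : v = u
        · simp [hv, huU, huX]
        · simp [hv]
      have hnot : u ∉ U' \ insert u X := by simp
      have hcard := Finset.card_insert_of_notMem hnot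
      have hadj := adjPairs_insert G hnot
      rw [← hset] at hcard hadj
      have hnotmax : adjPairs G (U' \ insert u X) + 2 * #(N (insert u X)) <
          D * (#(U' \ insert u X) + 1) := by
        by_contra! h
        have := hmax (insert u X) ⟨Finset.insert_subset huU hXU, hXc.insert hw hwu, h⟩
        rw [Finset.card_insert_of_notMem huX] at this
        omega
      have hNsub : (N X).erase u ∪ {v ∈ (U' \ insert u X) \ N X | G.Adj u v} ⊆
          N (insert u X) := by
        intro v hv
        simp only [Finset.mem_union, Finset.mem_erase, Finset.mem_filter, Finset.mem_sdiff,
          hmemN, Finset.mem_insert] at hv ⊢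
        rcases hv with ⟨hvu, ⟨h1, h2⟩, z, hz, hzv⟩ | ⟨⟨h1, -⟩, h2⟩
        · exact ⟨⟨h1, by tauto⟩, z, Or.inr hz, hzv⟩
        · exact ⟨h1, u, Or.inl rfl, h2⟩
      have hNdisj : Disjoint ((N X).erase u) {v ∈ (U' \ insert u X) \ N X | G.Adj u v} := by
        refine Finset.disjoint_left.2 fun v hv hv' => ?_
        exact (Finset.mem_sdiff.1 (Finset.mem_filter.1 hv').1).2 (Finset.mem_of_mem_erase hv)
      have hNcard := Finset.card_le_card hNsub
      rw [Finset.card_union_of_disjoint hNdisj, Finset.card_erase_of_mem hu] at hNcard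
      have hNpos : 0 < #(N X) := hNne.card_pos
      have hsplit : #{v ∈ U' \ insert u X | G.Adj u v} ≤
          #{v ∈ N X | G.Adj u v} + #{v ∈ (U' \ insert u X) \ N X | G.Adj u v} := by
        refine (Finset.card_le_card ?_).trans (Finset.card_union_le _ _)
        intro v hv
        simp only [Finset.mem_union, Finset.mem_filter, Finset.mem_sdiff] at hv ⊢
        tauto
      rw [hcard, mul_add] at hXD
      omega
    have hNdens : 2 * 2 ^ t * #(N X) ≤ adjPairs G (N X) := by
      rw [adjPairs_eq_sum, mul_comm]
      exact Finset.card_nsmul_le_sum _ _ _ hdeg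
    obtain ⟨P, hP, hPd, hPadj⟩ := ih (N X) hNne hNdens
    have hNX : Disjoint X (N X) :=
      Finset.disjoint_left.2 fun v hv hv' => ((hmemN X v).1 hv').1.2 hv
    refine ⟨Fin.cons X P, fun i => ?_, fun i j hij => ?_, fun i j hij => ?_⟩
    · refine Fin.cases ⟨hXc, hXU.trans hU'U⟩ (fun i => ⟨(hP i).1, (hP i).2.trans ?_⟩) i
      intro v hv
      exact hU'U ((hmemN X v).1 hv).1.1
    · induction i using Fin.cases with
      | zero =>
        induction j using Fin.cases with
        | zero => exact absurd rfl hij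
        | succ j => exact hNX.mono_right (hP j).2
      | succ i =>
        induction j using Fin.cases with
        | zero => exact (hNX.mono_right (hP i).2).symm
        | succ j => exact @hPd i j fun h => hij (congrArg Fin.succ h)
    · induction j using Fin.cases with
      | zero => exact absurd hij (Fin.not_lt_zero i)
      | succ j =>
        induction i using Fin.cases with
        | zero =>
          obtain ⟨v, hv⟩ := (hP j).1.nonempty
          obtain ⟨u, hu, huv⟩ := ((hmemN X v).1 ((hP j).2 hv)).2
          exact ⟨u, hu, v, hv, huv⟩
        | succ i => exact hPadj i j (Fin.succ_lt_succ_iff.1 hij)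

lemma hasKtMinor_of_two_pow_le_density {G : SimpleGraph V} {t : ℕ} (h : 2 ^ t ≤ density G) :
    HasKtMinor G t := by
  have hV : 0 < Fintype.card V := by
    rcases Nat.eq_zero_or_pos (Fintype.card V) with h0 | h0
    · have : (0 : ℝ) < 2 ^ t := by positivity
      rw [density_eq, h0] at h
      simp only [Nat.cast_zero, mul_zero, div_zero] at h
      linarith
    · exact h0
  have hV' : (0 : ℝ) < 2 * Fintype.card V := by positivity
  rw [density_eq, le_div_iff₀ hV'] at h
  have h' : 2 * 2 ^ t * #(univ : Finset V) ≤ adjPairs G univ := by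
    rw [Finset.card_univ]
    have : ((2 * 2 ^ t * Fintype.card V : ℕ) : ℝ) ≤ adjPairs G univ := by
      push_cast
      linarith
    exact_mod_cast this
  obtain ⟨P, h1, h2, h3⟩ := exists_branch_sets G t univ
    (Finset.card_pos.1 (by rwa [Finset.card_univ])) h'
  exact ⟨fun i => P i, fun i => Finset.coe_nonempty.2 (h1 i).1.nonempty,
    fun i j hij => Finset.disjoint_coe.2 (h2 hij), fun i => (h1 i).1, h3⟩

lemma nonempty_minorThreshold_set (t : ℕ) : {c : ℝ | ∀ (n : ℕ) (G : SimpleGraph (Fin n)),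
    density G ≥ c → HasKtMinor G t}.Nonempty :=
  ⟨2 ^ t, fun _ _ h => hasKtMinor_of_two_pow_le_density h⟩

lemma hasKtMinor_of_minorThreshold_lt_density {G : SimpleGraph V} {t : ℕ}
    (h : minorThreshold t < density G) : HasKtMinor G t := by
  obtain ⟨c, hc, hcd⟩ := exists_lt_of_csInf_lt (nonempty_minorThreshold_set t) h
  have e := G.overFinIso rfl
  have h1 : HasKtMinor (G.overFin rfl) t := hc _ _ (by rw [← density_congr e]; exact hcd.le)
  obtain ⟨P, h1, h2, h3, h4, -⟩ := h1.hasKtMinorOfOrder.of_embedding e.symm.toEmbedding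
  exact ⟨P, h1, h2, h3, h4⟩

lemma minorThreshold_pos {t : ℕ} (ht : 3 ≤ t) : 0 < minorThreshold t := by
  have h : (1 / 2 : ℝ) ≤ minorThreshold t := by
    refine le_csInf (nonempty_minorThreshold_set t) ?_
    intro c hc
    by_contra! hlt
    have hd : density (⊤ : SimpleGraph (Fin 2)) = 1 / 2 := by
      rw [density_eq]
      have : adjPairs (⊤ : SimpleGraph (Fin 2)) univ = 2 := by
        rw [adjPairs_eq_sum]
        simp [Finset.card_filter]
      rw [this]
      norm_num
    obtain ⟨P, hne, hdisj, -, -⟩ := hc 2 ⊤ (by rw [hd]; exact hlt.le)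
    choose f hf using hne
    have hinj : Function.Injective f := by
      intro i j hij
      by_contra hne
      exact Set.disjoint_left.1 (hdisj hne) (hf i) (hij ▸ hf j)
    have := Fintype.card_le_of_injective f hinj
    simp at this
    omega
  linarith

lemma eventually_pow_log_log_le (Z : ℕ) {K A : ℝ} (hK : 0 < K) (hA : 0 < A) :
    ∀ᶠ n : ℕ in Filter.atTop, (A * Real.log (K * Real.log n)) ^ Z ≤ Real.log n := by
  have hlog : Filter.Tendsto (fun n : ℕ => Real.log n) Filter.atTop Filter.atTop :=
    Real.tendsto_log_atTop.comp tendsto_natCast_atTop_atTop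
  have h1 := (isLittleO_pow_log_id_atTop (n := Z)).bound (show 0 < 1 / (A ^ Z * K) by positivity)
  filter_upwards [(hlog.const_mul_atTop hK).eventually h1, hlog.eventually_ge_atTop 0] with n h2 h3
  simp only [id, Real.norm_eq_abs] at h2
  rw [abs_of_nonneg (by positivity : 0 ≤ K * Real.log n)] at h2
  calc (A * Real.log (K * Real.log n)) ^ Z = A ^ Z * Real.log (K * Real.log n) ^ Z := mul_pow ..
    _ ≤ A ^ Z * (1 / (A ^ Z * K) * (K * Real.log n)) := by
        gcongr
        exact (le_abs_self _).trans h2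
    _ = Real.log n := by field_simp

lemma exists_minor_of_order_log {t : ℕ} (ht : 3 ≤ t) {ε : ℝ} (hε : 0 < ε) :
    ∃ K : ℝ, 0 < K ∧ ∀ᶠ n : ℕ in Filter.atTop, ∀ G : SimpleGraph (Fin n),
      minorThreshold t + ε ≤ density G → HasKtMinorOfOrder G t (K * Real.log n) := by
  have hc := minorThreshold_pos ht
  obtain ⟨K₁, hK₁, H₁⟩ := exists_minor_or_small_dense_subset (t := t) (by omega) hc.le hε
  obtain ⟨K₂, hK₂, H₂⟩ := exists_minor_or_small_dense_subset (t := t) (by omega) hc.le (half_pos hε)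
  have hZ : (0 : ℝ) < (20 * t ^ 3 : ℕ) := by
    have : 0 < 20 * t ^ 3 := by positivity
    exact_mod_cast this
  have hlog : Filter.Tendsto (fun n : ℕ => Real.log n) Filter.atTop Filter.atTop :=
    Real.tendsto_log_atTop.comp tendsto_natCast_atTop_atTop
  refine ⟨max K₁ K₂, by positivity, ?_⟩
  filter_upwards [eventually_pow_log_log_le (20 * t ^ 3) (K := K₁) (by linarith)
    (A := K₂ * (20 * t ^ 3 : ℕ)) (by positivity), hlog.eventually_ge_atTop 1] with n hn hn1 G hG
  rcases H₁ (Fin n) G hG with h | ⟨U, hU, hUd⟩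
  · refine h.mono ?_
    rw [Fintype.card_fin]
    gcongr
    exact le_max_left _ _
  rw [Fintype.card_fin] at hU
  have hcardU : Fintype.card (U : Set (Fin n)) = #U := by simp
  rcases H₂ _ _ hUd with h | ⟨U', hU', hUd'⟩
  · refine (h.of_embedding (SimpleGraph.Embedding.induce _)).mono ?_
    have h1 : Real.log (#U : ℝ) ≤ Real.log n := by
      rcases Nat.eq_zero_or_pos #U with h0 | h0
      · rw [h0, Nat.cast_zero, Real.log_zero]
        linarith
      · refine Real.log_le_log (by exact_mod_cast h0) ?_
        exact_mod_cast (Finset.card_le_univ U).trans (Fintype.card_fin n).le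
    rw [hcardU]
    exact mul_le_mul (le_max_right _ _) h1 (Real.log_natCast_nonneg _) (by positivity)
  · have h1 : Real.log (#U : ℝ) ≤ (20 * t ^ 3 : ℕ) * Real.log (K₁ * Real.log n) := by
      rcases Nat.eq_zero_or_pos #U with h0 | h0
      · rw [h0, Nat.cast_zero, Real.log_zero]
        exact mul_nonneg hZ.le (Real.log_nonneg (by nlinarith))
      · rw [← Real.log_pow]
        exact Real.log_le_log (by exact_mod_cast h0) hU
    have h2 : (#U' : ℝ) ≤ Real.log n := by
      refine hU'.trans (le_trans (pow_le_pow_left₀ ?_ ?_ _) hn)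
      · exact mul_nonneg (by linarith) (Real.log_natCast_nonneg _)
      · rw [hcardU, mul_assoc]
        exact mul_le_mul_of_nonneg_left h1 (by linarith)
    have h3 := (hasKtMinor_of_minorThreshold_lt_density (t := t)
      (lt_of_lt_of_le (by linarith) hUd')).hasKtMinorOfOrder
    refine ((h3.of_embedding (SimpleGraph.Embedding.induce _)).of_embedding
      (SimpleGraph.Embedding.induce _)).mono ?_
    have h4 : Nat.card (U' : Set (U : Set (Fin n))) = #U' := by simp
    rw [h4]
    have h5 : 1 ≤ max K₁ K₂ := hK₁.trans (le_max_left _ _)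
    nlinarith

end ExpanderMinors

/-- Theorem 1 (main theorem): every graph of density at least `c(t) + ε` on sufficiently
many vertices contains a `K_t`-minor of order `O((c(t)·t²/ε)·log n·log log n)`. -/
theorem stmt_0 :
    ∃ C : ℝ, 0 < C ∧
      ∀ ε : ℝ, 0 < ε → ∀ t : ℕ, 3 ≤ t → ∃ n₀ : ℕ,
        ∀ n : ℕ, n₀ ≤ n → ∀ G : SimpleGraph (Fin n),
          density G ≥ minorThreshold t + ε →
            HasKtMinorOfOrder G t
              (C * (minorThreshold t * t ^ 2 / ε) * logb 2 n * logb 2 (logb 2 n)) := by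
  refine ⟨1, one_pos, fun ε hε t ht => ?_⟩
  obtain ⟨K, hK, hmin⟩ := exists_minor_of_order_log ht hε
  have hc := minorThreshold_pos ht
  have hB : 0 < minorThreshold t * t ^ 2 / ε := by positivity
  set B := minorThreshold t * t ^ 2 / ε
  have hlog : Filter.Tendsto (fun n : ℕ => Real.logb 2 n) Filter.atTop Filter.atTop :=
    (Real.tendsto_logb_atTop one_lt_two).comp tendsto_natCast_atTop_atTop
  have hloglog := (Real.tendsto_logb_atTop one_lt_two).comp hlog
  obtain ⟨n₀, hn₀⟩ := Filter.eventually_atTop.1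
    (hmin.and (hloglog.eventually_ge_atTop (K / B)))
  refine ⟨n₀, fun n hn G hG => ?_⟩
  obtain ⟨h1, h2⟩ := hn₀ n hn
  refine (h1 G hG).mono ?_
  have h3 : Real.log n ≤ Real.logb 2 n := by
    rw [Real.logb, le_div_iff₀ (Real.log_pos one_lt_two)]
    have h4 := Real.log_natCast_nonneg n
    have h5 := Real.log_two_lt_d9
    nlinarith
  have h4 : K ≤ B * Real.logb 2 (Real.logb 2 n) := by
    rw [mul_comm]
    exact (div_le_iff₀ hB).1 h2
  have h5 : 0 ≤ Real.logb 2 n := (Real.log_natCast_nonneg n).trans h3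
  calc K * Real.log n ≤ K * Real.logb 2 n := by gcongr
    _ ≤ B * Real.logb 2 (Real.logb 2 n) * Real.logb 2 n := by gcongr
    _ = 1 * B * Real.logb 2 n * Real.logb 2 (Real.logb 2 n) := by ring
end

section
/- Let G be a finite nonempty simple graph with d(G) = c. Then for every δ with 0 < δ ≤ 1/256, G contains a subgraph H such that d(H) ≥ (1−δ)c and H is a δ-expander. -/
open Real

/-- The relative density loss allowed on an `n`-vertex graph. -/
noncomputable def lossBound (δ : ℝ) (n : ℕ) : ℝ :=
  if n < 512 then 0 else δ * (1 - 1 / logb 2 (logb 2 n))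

lemma nine_le_logb {n : ℕ} (hn : 512 ≤ n) : 9 ≤ logb 2 n := by
  rw [le_logb_iff_rpow_le (by norm_num) (by positivity)]
  norm_num
  exact hn

lemma one_le_logb_logb {n : ℕ} (hn : 512 ≤ n) : 1 ≤ logb 2 (logb 2 n) := by
  have h := nine_le_logb hn
  rw [le_logb_iff_rpow_le (by norm_num) (by linarith)]
  norm_num
  linarith

lemma lossBound_mono {δ : ℝ} (hδ : 0 < δ) {a b : ℕ} (hab : a ≤ b) :
    lossBound δ a ≤ lossBound δ b := by
  unfold lossBound
  split_ifs with h1 h2 h2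
  · exact le_rfl
  · have h := one_le_logb_logb (not_lt.mp h2)
    have : 1 / logb 2 (logb 2 b) ≤ 1 := by
      rw [div_le_one (by linarith)]
      exact h
    exact mul_nonneg hδ.le (by linarith)
  · omega
  · have h := one_le_logb_logb (not_lt.mp h1)
    have h9 := nine_le_logb (not_lt.mp h1)
    have ha : (0 : ℝ) < a := by
      have : 0 < a := by omega
      exact_mod_cast this
    have hab' : (a : ℝ) ≤ b := by exact_mod_cast hab
    have hlog : logb 2 (logb 2 a) ≤ logb 2 (logb 2 b) :=
      logb_le_logb_of_le (by norm_num) (by linarith)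
        (logb_le_logb_of_le (by norm_num) ha hab')
    have := one_div_le_one_div_of_le (by linarith) hlog
    exact mul_le_mul_of_nonneg_left (by linarith) hδ.le

lemma lossBound_le {δ : ℝ} (hδ : 0 < δ) (n : ℕ) : lossBound δ n ≤ δ := by
  unfold lossBound
  split_ifs with h
  · exact hδ.le
  · have h := one_le_logb_logb (not_lt.mp h)
    have : 0 ≤ 1 / logb 2 (logb 2 n) := by positivity
    nlinarith

lemma lossBound_nonneg {δ : ℝ} (hδ : 0 < δ) (n : ℕ) : 0 ≤ lossBound δ n := by
  have h := lossBound_mono hδ (Nat.zero_le n)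
  simpa [lossBound] using h

/-- Relative increase of a double logarithm when the logarithm grows by a definite amount. -/
lemma div_le_inv_logb_sub {x y t : ℝ} (hx : 1 < x) (hxy : x ≤ y) (ht : t ≤ 4 / 3 * (y - x)) :
    t / (y * logb 2 y ^ 2) ≤ 1 / logb 2 x - 1 / logb 2 y := by
  have hlx : 0 < logb 2 x := logb_pos (by norm_num) hx
  have hlxy : logb 2 x ≤ logb 2 y := logb_le_logb_of_le (by norm_num) (by linarith) hxy
  have hly : 0 < logb 2 y := by linarith
  have hy : 0 < y := by linarith
  have hdiff : 4 / 3 * (1 - x / y) ≤ logb 2 y - logb 2 x := by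
    rw [← logb_div hy.ne' (by linarith), logb, le_div_iff₀ (log_pos (by norm_num))]
    have h := one_sub_inv_le_log_of_pos (show 0 < y / x by positivity)
    rw [inv_div] at h
    have h1 : 0 ≤ 1 - x / y := by
      rw [sub_nonneg, div_le_one hy]
      exact hxy
    have h2 := log_two_lt_d9
    nlinarith
  have hty : t / y ≤ logb 2 y - logb 2 x := by
    refine le_trans ?_ hdiff
    rw [div_le_iff₀ hy]
    have : x / y * y = x := by field_simp
    nlinarith
  rw [← div_div, div_sub_div _ _ hlx.ne' hly.ne']
  have h0 : 0 ≤ 1 * logb 2 y - logb 2 x * 1 := by linarith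
  calc t / y / logb 2 y ^ 2 ≤ (1 * logb 2 y - logb 2 x * 1) / logb 2 y ^ 2 := by
        gcongr
        linarith
    _ ≤ _ := by
        apply div_le_div_of_nonneg_left h0 (by positivity)
        nlinarith

/-- The expansion factor required of an `m`-vertex `δ`-expander at level `d`. -/
noncomputable abbrev expansionRate (δ : ℝ) (m d : ℕ) : ℝ :=
  δ * 2 ^ d / (logb 2 m * (logb 2 (logb 2 m)) ^ 2)

lemma two_pow_succ_le_logb {m d : ℕ} (hd : (d : ℝ) ≤ logb 2 (logb 2 m) - 1) :
    2 * (2 : ℝ) ^ d ≤ logb 2 m := by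
  have hL : 0 < logb 2 (m : ℝ) := by
    have h0 : 0 ≤ logb 2 (m : ℝ) := by
      rcases Nat.eq_zero_or_pos m with rfl | hm
      · simp
      · exact logb_nonneg (by norm_num) (by exact_mod_cast hm)
    refine h0.lt_of_ne fun h => ?_
    rw [← h, logb_zero] at hd
    have : (0 : ℝ) ≤ d := by positivity
    linarith
  have h : ((d + 1 : ℕ) : ℝ) ≤ logb 2 (logb 2 m) := by
    push_cast
    linarith
  rw [le_logb_iff_rpow_le (by norm_num) hL, rpow_natCast, pow_succ] at h
  linarith

lemma expansionRate_bounds {δ : ℝ} (hδ : 0 < δ) (hδ' : δ ≤ 1 / 256) {m d : ℕ}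
    (hd : (d : ℝ) ≤ logb 2 (logb 2 m) - 1) :
    0 ≤ expansionRate δ m d ∧ expansionRate δ m d ≤ 1 / 512 := by
  have hL := two_pow_succ_le_logb hd
  have hp : (0 : ℝ) < 2 ^ d := by positivity
  have hLL : 1 ≤ logb 2 (logb 2 (m : ℝ)) := by
    have : (0 : ℝ) ≤ d := by positivity
    linarith
  have hL0 : 0 < logb 2 (m : ℝ) := by linarith
  refine ⟨by positivity, ?_⟩
  rw [expansionRate, div_le_iff₀ (by positivity)]
  have h1 : 1 ≤ logb 2 (logb 2 (m : ℝ)) ^ 2 := one_le_pow₀ hLL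
  nlinarith

lemma expansionRate_le_lossBound_sub {δ : ℝ} (hδ : 0 < δ) (hδ' : δ ≤ 1 / 256) {m d s n : ℕ}
    (hd : (d : ℝ) ≤ logb 2 (logb 2 m) - 1)
    (hs : (s : ℝ) ≤ (m : ℝ) / (2 : ℝ) ^ (2 ^ d : ℕ)) (hn : 1 ≤ n)
    (hns : (n : ℝ) < expansionRate δ m d * s) :
    expansionRate δ m d ≤ lossBound δ m - lossBound δ (s + n) := by
  obtain ⟨hε0, hε⟩ := expansionRate_bounds hδ hδ' hd
  have hn' : (1 : ℝ) ≤ n := by exact_mod_cast hn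
  have hs0 : (0 : ℝ) ≤ s := by positivity
  have hs512 : (512 : ℝ) < s := by nlinarith
  have hp : (1 : ℝ) ≤ 2 ^ d := one_le_pow₀ (by norm_num)
  have hpp : (1 : ℝ) ≤ 2 ^ (2 ^ d : ℕ) := one_le_pow₀ (by norm_num)
  have hsm : (s : ℝ) ≤ m := hs.trans (div_le_self (by positivity) hpp)
  have hs512' : 512 ≤ s := by exact_mod_cast hs512.le
  have hm512 : 512 ≤ m := hs512'.trans (by exact_mod_cast hsm)
  have hm0 : (0 : ℝ) < m := by linarith
  have hL' : logb 2 ((s + n : ℕ) : ℝ) ≤ 1 / 4 + (logb 2 m - 2 ^ d) := by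
    have hle : ((s + n : ℕ) : ℝ) ≤
        (1 + expansionRate δ m d) * ((m : ℝ) / 2 ^ (2 ^ d : ℕ)) := by
      push_cast
      nlinarith
    have h1 : logb 2 (1 + expansionRate δ m d) ≤ 1 / 4 := by
      rw [logb, div_le_iff₀ (log_pos (by norm_num))]
      have h2 := log_two_gt_d9
      have h3 := log_le_sub_one_of_pos (show 0 < 1 + expansionRate δ m d by linarith)
      linarith
    refine (logb_le_logb_of_le (by norm_num) (by push_cast; linarith) hle).trans ?_
    rw [logb_mul (by linarith) (by positivity), logb_div (by positivity) (by positivity),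
      logb_pow, logb_self_eq_one (by norm_num)]
    push_cast
    linarith
  have h9 : 9 ≤ logb 2 ((s + n : ℕ) : ℝ) := nine_le_logb (by omega)
  have key := div_le_inv_logb_sub (x := logb 2 ((s + n : ℕ) : ℝ)) (y := logb 2 (m : ℝ))
    (t := 2 ^ d) (by linarith) (by linarith) (by linarith)
  rw [lossBound, lossBound, if_neg (by omega), if_neg (by omega), expansionRate, mul_div_assoc,
    ← mul_sub]
  refine mul_le_mul_of_nonneg_left ?_ hδ.le
  linarith

section Graph

variable {V : Type*} (G : SimpleGraph V)

/-- The edges of `G` with both ends in `U`. -/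
def edgesWithin (U : Set V) : Set (Sym2 V) :=
  {e ∈ G.edgeSet | ∀ v ∈ e, v ∈ U}

lemma density_induce_s1 (U : Set V) :
    density ((⊤ : G.Subgraph).induce U).coe = (edgesWithin G U).ncard / U.ncard := by
  have h : edgesWithin G U = ((⊤ : G.Subgraph).induce U).edgeSet := by
    ext e
    induction e with
    | _ a b => simp [edgesWithin]; tauto
  rw [density, h, ← SimpleGraph.Subgraph.image_coe_edgeSet_coe,
    Set.ncard_image_of_injective _ (Sym2.map.injective Subtype.val_injective)]
  rfl

lemma ncard_edgesWithin_le [Finite V] {U S N : Set V}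
    (hN : ∀ u ∈ S, ∀ v ∈ U, v ∉ S → G.Adj u v → v ∈ N) :
    (edgesWithin G U).ncard ≤
      (edgesWithin G (U \ S)).ncard + (edgesWithin G (S ∪ N)).ncard := by
  refine (Set.ncard_le_ncard ?_ (Set.toFinite _)).trans (Set.ncard_union_le _ _)
  intro e
  induction e with
  | _ a b =>
    have h1 := hN a
    have h2 := hN b
    simp only [edgesWithin, Set.mem_union, Set.mem_ofPred_eq, SimpleGraph.mem_edgeSet,
      Sym2.mem_iff, forall_eq_or_imp, forall_eq, Set.mem_sdiff]
    have := G.adj_comm a b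
    grind

/-- A set violating expansion inside the subgraph induced on `U`. -/
lemma exists_of_not_isDeltaExpander {U : Set V} {δ : ℝ}
    (h : ¬ IsDeltaExpander ((⊤ : G.Subgraph).induce U).coe δ) :
    ∃ (d : ℕ) (S N : Set V), (d : ℝ) ≤ logb 2 (logb 2 U.ncard) - 1 ∧ S ⊆ U ∧
      Disjoint S N ∧ (S.ncard : ℝ) ≤ (U.ncard : ℝ) / (2 : ℝ) ^ (2 ^ d : ℕ) ∧
      (N.ncard : ℝ) < expansionRate δ U.ncard d * S.ncard ∧
      ∀ u ∈ S, ∀ v ∈ U, v ∉ S → G.Adj u v → v ∈ N := by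
  have hcard : Nat.card ((⊤ : G.Subgraph).induce U).verts = U.ncard := rfl
  simp only [IsDeltaExpander, hcard] at h
  push Not at h
  obtain ⟨d, hd, S, hS, hN⟩ := h
  refine ⟨d, Subtype.val '' S, Subtype.val '' nbhd ((⊤ : G.Subgraph).induce U).coe S, hd, ?_,
    ?_, ?_, ?_, ?_⟩
  · rintro _ ⟨x, -, rfl⟩
    exact x.2
  · rw [Set.disjoint_image_iff Subtype.val_injective, Set.disjoint_left]
    exact fun x hx hx' => hx'.1 hx
  · rwa [Set.ncard_image_of_injective _ Subtype.val_injective]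
  · rwa [Set.ncard_image_of_injective _ Subtype.val_injective,
      Set.ncard_image_of_injective _ Subtype.val_injective]
  · rintro _ ⟨x, hx, rfl⟩ v hv hvS hadj
    refine ⟨⟨v, hv⟩, ⟨fun h => hvS ⟨_, h, rfl⟩, x, hx, ?_⟩, rfl⟩
    simp only [SimpleGraph.Subgraph.coe_adj, SimpleGraph.Subgraph.induce_adj,
      SimpleGraph.Subgraph.top_adj]
    exact ⟨x.2, hv, hadj⟩

theorem exists_isDeltaExpander_induce [Finite V] {δ : ℝ} (hδ : 0 < δ) (hδ' : δ ≤ 1 / 256) (k : ℕ) :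
    ∀ U : Set V, U.ncard = k → ∃ W : Set V,
      (1 - lossBound δ k) * density ((⊤ : G.Subgraph).induce U).coe ≤
        density ((⊤ : G.Subgraph).induce W).coe ∧
      IsDeltaExpander ((⊤ : G.Subgraph).induce W).coe δ := by
  induction k using Nat.strong_induction_on with
  | _ k ih =>
  intro U hU
  have hD0 : 0 ≤ density ((⊤ : G.Subgraph).induce U).coe := by
    unfold density
    positivity
  by_cases hexp : IsDeltaExpander ((⊤ : G.Subgraph).induce U).coe δ
  · exact ⟨U, by nlinarith [lossBound_nonneg hδ k], hexp⟩
  obtain ⟨d, S, N, hd, hSU, hdisj, hS, hN, hadj⟩ := exists_of_not_isDeltaExpander G hexp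
  rw [hU] at hd hS hN
  obtain ⟨hε0, hε⟩ := expansionRate_bounds hδ hδ' hd
  set ε := expansionRate δ k d
  set D := density ((⊤ : G.Subgraph).induce U).coe with hD
  have hSpos : (0 : ℝ) < S.ncard := by
    have : (0 : ℝ) ≤ N.ncard := by positivity
    by_contra! hcon
    nlinarith
  have hS2 : (S.ncard : ℝ) ≤ k / 2 := by
    refine hS.trans (div_le_div_of_nonneg_left (by positivity) (by norm_num) ?_)
    exact le_self_pow₀ (by norm_num) (by positivity)
  have hstep : ∀ W : Set V, W.ncard < k → ∀ η : ℝ, 0 ≤ η →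
      η ≤ lossBound δ k - lossBound δ W.ncard →
      (1 - η) * D ≤ density ((⊤ : G.Subgraph).induce W).coe →
      ∃ W : Set V, (1 - lossBound δ k) * D ≤ density ((⊤ : G.Subgraph).induce W).coe ∧
        IsDeltaExpander ((⊤ : G.Subgraph).induce W).coe δ := by
    intro W hW η hη hηl hdens
    obtain ⟨X, hX, hX'⟩ := ih _ hW W rfl
    refine ⟨X, le_trans ?_ hX, hX'⟩
    have h1 := lossBound_le hδ W.ncard
    have h2 := lossBound_nonneg hδ W.ncard
    have h3 := mul_le_mul_of_nonneg_left hdens (show 0 ≤ 1 - lossBound δ W.ncard by linarith)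
    refine le_trans ?_ h3
    rw [← mul_assoc]
    refine mul_le_mul_of_nonneg_right ?_ hD0
    nlinarith [mul_nonneg hη h2]
  have hcardSU : (U \ S).ncard + S.ncard = k := hU ▸ Set.ncard_sdiff_add_ncard_of_subset hSU
  have hcardR : ((U \ S).ncard : ℝ) + S.ncard = k := by exact_mod_cast hcardSU
  have hSpos' : 0 < S.ncard := by exact_mod_cast hSpos
  by_cases hcase : D ≤ density ((⊤ : G.Subgraph).induce (U \ S)).coe
  · have hlt : (U \ S).ncard < k := by omega
    exact hstep (U \ S) hlt 0 le_rfl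
      (sub_nonneg.mpr (lossBound_mono hδ hlt.le)) (by linarith)
  have hcardSN : (S ∪ N).ncard = S.ncard + N.ncard := Set.ncard_union_eq hdisj
  have hpos1 : (0 : ℝ) < (U \ S).ncard := by linarith
  have hdens : D * S.ncard ≤
      density ((⊤ : G.Subgraph).induce (S ∪ N)).coe * ((S.ncard : ℝ) + N.ncard) := by
    have hE : ((edgesWithin G U).ncard : ℝ) ≤
        (edgesWithin G (U \ S)).ncard + (edgesWithin G (S ∪ N)).ncard := by
      exact_mod_cast ncard_edgesWithin_le G hadj
    have hEU : ((edgesWithin G U).ncard : ℝ) = D * k := by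
      rw [hD, density_induce_s1, hU, div_mul_cancel₀]
      linarith
    have hED : ((edgesWithin G (U \ S)).ncard : ℝ) ≤ D * (U \ S).ncard := by
      rw [not_le, density_induce_s1, div_lt_iff₀ hpos1] at hcase
      exact hcase.le
    rw [density_induce_s1, hcardSN, Nat.cast_add, div_mul_cancel₀ _ (by positivity)]
    rw [← hcardR] at hEU
    linarith
  have hltSN : (S ∪ N).ncard < k := by
    rw [hcardSN]
    have : (S.ncard : ℝ) + N.ncard < k := by nlinarith
    exact_mod_cast this
  have hD1 : 0 ≤ density ((⊤ : G.Subgraph).induce (S ∪ N)).coe := by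
    unfold density
    positivity
  rcases Nat.eq_zero_or_pos N.ncard with hN0 | hN1
  · refine hstep (S ∪ N) hltSN 0 le_rfl (sub_nonneg.mpr (lossBound_mono hδ hltSN.le)) ?_
    rw [hN0, Nat.cast_zero, add_zero] at hdens
    linarith [le_of_mul_le_mul_right hdens hSpos]
  · refine hstep (S ∪ N) hltSN ε hε0 ?_ ?_
    · rw [hcardSN]
      exact expansionRate_le_lossBound_sub hδ hδ' hd hS hN1 hN
    · set D' := density ((⊤ : G.Subgraph).induce (S ∪ N)).coe
      have h1 : D * S.ncard ≤ D' * (1 + ε) * S.ncard := by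
        refine hdens.trans ?_
        rw [mul_assoc]
        exact mul_le_mul_of_nonneg_left (by linarith) hD1
      have h2 : D ≤ D' * (1 + ε) := le_of_mul_le_mul_right h1 hSpos
      nlinarith [mul_nonneg hD1 (mul_nonneg hε0 hε0)]

end Graph

/-- Key Lemma: every nonempty graph of density `c` contains a subgraph `H` with
`d(H) ≥ (1−δ)c` which is a `δ`-expander. -/
theorem stmt_1 {V : Type} [Fintype V] [Nonempty V] (G : SimpleGraph V) (c : ℝ)
    (hc : density G = c) :
    ∀ δ : ℝ, 0 < δ → δ ≤ 1 / 256 →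
      ∃ H : G.Subgraph, density H.coe ≥ (1 - δ) * c ∧ IsDeltaExpander H.coe δ := by
  intro δ hδ hδ'
  obtain ⟨W, hW, hW'⟩ := exists_isDeltaExpander_induce G hδ hδ' _ Set.univ rfl
  refine ⟨_, le_trans ?_ hW, hW'⟩
  have huniv : density ((⊤ : G.Subgraph).induce Set.univ).coe = c := by
    rw [density_induce_s1, ← hc, density, Set.ncard_univ]
    simp [edgesWithin]
  have hc0 : 0 ≤ c := by
    rw [← hc, density]
    positivity
  rw [huniv]
  exact mul_le_mul_of_nonneg_right (by linarith [lossBound_le hδ (Set.univ : Set V).ncard]) hc0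
end

section
/- Let G be a finite simple graph on n vertices with d(G) = c, let γ > 0, and let S be a nonempty proper subset of V(G) with |N(S)| < γ|S|. Then either the subgraph of G induced on V(G) \ S has d ≥ c, or the subgraph of G induced on S ∪ N(S) has d ≥ (1−γ)c. -/
open Real

theorem edgeSet_subset_induce_compl_union_induce_nbhd {V : Type*} (G : SimpleGraph V)
    (S : Set V) :
    G.edgeSet ⊆ Sym2.map Subtype.val '' (G.induce Sᶜ).edgeSet ∪
      Sym2.map Subtype.val '' (G.induce (S ∪ nbhd G S)).edgeSet := by
  intro e
  induction e using Sym2.ind with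
  | _ x y =>
    intro h
    rw [SimpleGraph.mem_edgeSet] at h
    by_cases hx : x ∈ S
    · have hy : y ∈ S ∪ nbhd G S := by
        by_cases hy : y ∈ S
        · exact Or.inl hy
        · exact Or.inr ⟨hy, x, hx, h⟩
      exact Or.inr ⟨s(⟨x, Or.inl hx⟩, ⟨y, hy⟩), h, rfl⟩
    · by_cases hy : y ∈ S
      · exact Or.inr ⟨s(⟨x, Or.inr ⟨hx, y, hy, h.symm⟩⟩, ⟨y, Or.inl hy⟩), h, rfl⟩
      · exact Or.inl ⟨s(⟨x, hx⟩, ⟨y, hy⟩), h, rfl⟩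

theorem ncard_edgeSet_le_induce_compl_add_induce_nbhd {V : Type*} [Finite V]
    (G : SimpleGraph V) (S : Set V) :
    G.edgeSet.ncard ≤
      (G.induce Sᶜ).edgeSet.ncard + (G.induce (S ∪ nbhd G S)).edgeSet.ncard :=
  (Set.ncard_le_ncard (edgeSet_subset_induce_compl_union_induce_nbhd G S)
    (Set.toFinite _)).trans <| (Set.ncard_union_le _ _).trans <|
      add_le_add (Set.ncard_image_le (Set.toFinite _)) (Set.ncard_image_le (Set.toFinite _))

/-- Claim 2.1: if `|N(S)| < γ|S|` then either `G[V ∖ S]` has density at least `c`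
or `G[S ∪ N(S)]` has density at least `(1−γ)c`. -/
theorem stmt_2 {V : Type} [Fintype V] (G : SimpleGraph V) (c γ : ℝ)
    (hc : density G = c) (hγ : 0 < γ) (S : Set V) (hS : S.Nonempty)
    (hSproper : S ≠ Set.univ)
    (hN : ((nbhd G S).ncard : ℝ) < γ * S.ncard) :
    density (G.induce Sᶜ) ≥ c ∨
      density (G.induce (S ∪ nbhd G S)) ≥ (1 - γ) * c := by
  have hle : (G.edgeSet.ncard : ℝ) ≤
      (G.induce Sᶜ).edgeSet.ncard + (G.induce (S ∪ nbhd G S)).edgeSet.ncard := by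
    exact_mod_cast ncard_edgeSet_le_induce_compl_add_induce_nbhd G S
  have hs : (0 : ℝ) < S.ncard := by exact_mod_cast (Set.ncard_pos (Set.toFinite S)).2 hS
  have hs' : (0 : ℝ) < Sᶜ.ncard := by
    exact_mod_cast (Set.ncard_pos (Set.toFinite _)).2 (Set.nonempty_compl.2 hSproper)
  have hcard : (S.ncard : ℝ) + Sᶜ.ncard = Nat.card V := by
    exact_mod_cast Set.ncard_add_ncard_compl S
  have hunion : ((S ∪ nbhd G S).ncard : ℝ) = S.ncard + (nbhd G S).ncard := by
    have hdisj : Disjoint S (nbhd G S) := Set.disjoint_left.2 fun _ hv hv' => hv'.1 hv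
    exact_mod_cast Set.ncard_union_eq hdisj (Set.toFinite _) (Set.toFinite _)
  have hc0 : 0 ≤ c := hc ▸ div_nonneg (Nat.cast_nonneg _) (Nat.cast_nonneg _)
  have hE : (G.edgeSet.ncard : ℝ) = c * (S.ncard + Sᶜ.ncard) := by
    rw [hcard, ← hc, density, div_mul_cancel₀]
    rw [← hcard]
    positivity
  rw [or_iff_not_imp_left, ge_iff_le, not_le, density, Nat.card_coe_set_eq,
    div_lt_iff₀ hs']
  intro hlt
  rw [density, Nat.card_coe_set_eq, hunion, ge_iff_le, le_div_iff₀ (by positivity)]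
  have hbound : (1 - γ) * (S.ncard + (nbhd G S).ncard : ℝ) ≤ S.ncard := by
    rcases le_total γ 1 with h | h
    · nlinarith [mul_le_mul_of_nonneg_left hN.le (sub_nonneg.2 h),
        mul_nonneg (sq_nonneg γ) hs.le]
    · exact (mul_nonpos_of_nonpos_of_nonneg (sub_nonpos.2 h) (by positivity)).trans hs.le
  nlinarith [mul_le_mul_of_nonneg_left hbound hc0]
end
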